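/- Let n be a positive integer, p a prime and d ≥ 1, and suppose the symmetric group S_n has a nontrivial irreducible complex representation of degree p^d. Then one of the following holds: (1) n = p^d + 1; (2) n = 4 and p^d = 2; (3) n = 5 and p^d = 5; (4) n = 6 and p^d ∈ {9, 16}; (5) n = 8 and p^d = 64; (6) n = 9 and p^d = 27. -/

import Mathlib

open CategoryTheory

/-- The set of degrees of irreducible complex representations of `G`. -/
noncomputable def cd (G : Type) [Group G] : Set ℕ :=
  {d | ∃ V : FDRep ℂ G, Simple V ∧ Module.finrank ℂ V = d}

section

open Finset

section GeometricSeries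

variable {τ : Type*}

/-- The geometric series `∑ m, X ^ (m • v)`. -/
noncomputable def geomSeries (v : τ →₀ ℕ) : MvPowerSeries τ ℤ :=
  open scoped Classical in fun e => if ∃ m : ℕ, e = m • v then 1 else 0

open scoped Classical in
theorem coeff_geomSeries (v e : τ →₀ ℕ) :
    MvPowerSeries.coeff e (geomSeries v) = if ∃ m : ℕ, e = m • v then 1 else 0 := rfl

theorem geomSeries_mul (v : τ →₀ ℕ) (hv : v ≠ 0) :
    geomSeries v * (1 - MvPowerSeries.monomial v 1) = 1 := by
  classical
  ext e
  rw [mul_sub, mul_one, map_sub, MvPowerSeries.coeff_mul_monomial, coeff_geomSeries,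
    coeff_geomSeries, MvPowerSeries.coeff_one, mul_one]
  by_cases h : ∃ m : ℕ, e = m • v
  · obtain ⟨m, rfl⟩ := h
    rw [if_pos ⟨m, rfl⟩]
    cases m with
    | zero =>
      have : ¬ v ≤ 0 := fun h => hv (le_antisymm h (zero_le))
      simp [this]
    | succ m =>
      have h1 : v ≤ (m + 1) • v := by
        rw [succ_nsmul]; exact le_add_of_nonneg_left (zero_le)
      have h2 : ∃ l : ℕ, (m + 1) • v - v = l • v := ⟨m, by rw [succ_nsmul]; simp⟩
      have h3 : (m + 1) • v ≠ 0 := by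
        intro h
        rw [succ_nsmul] at h
        simp at h; exact hv h.2
      rw [if_pos h1, if_pos h2, if_neg h3]; rfl
  · rw [if_neg h]
    have h0 : e ≠ 0 := fun h0 => h ⟨0, by simp [h0]⟩
    rw [if_neg h0]
    by_cases h1 : v ≤ e
    · have h2 : ¬ ∃ m : ℕ, e - v = m • v := by
        rintro ⟨m, hm⟩
        exact h ⟨m + 1, by rw [succ_nsmul, ← hm, tsub_add_cancel_of_le h1]⟩
      rw [if_pos h1, if_neg h2]; rfl
    · rw [if_neg h1]; rfl

theorem coeff_prod_geomSeries {P : Type*} [Fintype P] [DecidableEq P] [DecidableEq τ]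
    (v : P → τ →₀ ℕ) (hv : ∀ p, v p ≠ 0) (d : τ →₀ ℕ) :
    MvPowerSeries.coeff d (∏ p, geomSeries (v p)) =
      (Nat.card {m : P → ℕ // ∑ p, m p • v p = d} : ℤ) := by
  classical
  rw [MvPowerSeries.coeff_prod]
  simp_rw [coeff_geomSeries]
  have h1 : ∀ l : P →₀ (τ →₀ ℕ),
      (∏ p, if ∃ m : ℕ, l p = m • v p then (1 : ℤ) else 0) =
        if ∀ p, ∃ m : ℕ, l p = m • v p then 1 else 0 := by
    intro l
    split_ifs with h
    · exact Finset.prod_eq_one fun p _ => if_pos (h p)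
    · push Not at h
      obtain ⟨p, hp⟩ := h
      exact Finset.prod_eq_zero (mem_univ p) (if_neg (by simpa using hp))
  simp_rw [h1]
  rw [Finset.sum_boole]
  congr 1
  rw [← Nat.card_eq_finsetCard]
  symm
  refine Nat.card_congr (Equiv.ofBijective
    (fun m => ⟨Finsupp.equivFunOnFinite.symm fun p => m.1 p • v p, ?_⟩) ⟨?_, ?_⟩)
  · rw [mem_filter, mem_finsuppAntidiag]
    refine ⟨⟨?_, subset_univ _⟩, fun p => ⟨m.1 p, rfl⟩⟩
    simpa using m.2
  · rintro ⟨m, hm⟩ ⟨m', hm'⟩ h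
    ext p
    have h2 := DFunLike.congr_fun (congrArg Subtype.val h) p
    simp only [Finsupp.equivFunOnFinite_symm_apply_apply] at h2
    obtain ⟨t, ht⟩ := Finsupp.ne_iff.mp (hv p)
    have h3 := DFunLike.congr_fun h2 t
    simp only [Finsupp.smul_apply, smul_eq_mul] at h3
    exact Nat.eq_of_mul_eq_mul_right (Nat.pos_of_ne_zero ht) h3
  · rintro ⟨l, hl⟩
    rw [mem_filter, mem_finsuppAntidiag] at hl
    choose m hm using hl.2
    refine ⟨⟨m, ?_⟩, ?_⟩
    · rw [← hl.1.1]
      exact Finset.sum_congr rfl fun p _ => (hm p).symm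
    · ext p : 2
      simp [hm p]

end GeometricSeries

section CauchyDeterminant

variable {N : ℕ}

theorem prod_prod_erase_eq {M : Type*} [CommMonoid M] (f : Fin N → Fin N → M) :
    ∏ j, ∏ i ∈ univ.erase j, f j i = ∏ j, ∏ i ∈ Ioi j, f j i * f i j := by
  have h : ∀ j : Fin N, univ.erase j = Iio j ∪ Ioi j := by
    intro j; ext i; simp only [mem_erase, mem_univ, and_true, mem_union, mem_Iio, mem_Ioi]
    exact ne_iff_lt_or_gt
  have h' : ∀ j : Fin N, Disjoint (Iio j) (Ioi j) := by
    intro j; rw [disjoint_left]; intro i; simp; exact fun h => h.le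
  simp_rw [h, prod_union (h' _), prod_mul_distrib]
  rw [mul_comm]
  congr 1
  exact prod_comm' (by simp)

theorem det_cauchy_field {K : Type*} [Field K] (x y : Fin N → K)
    (hy : ∀ i, y i ≠ 0) (hinj : Function.Injective y) :
    (Matrix.of fun i j => ∏ l ∈ univ.erase j, (1 - x i * y l)).det =
      (Matrix.vandermonde x).det * (Matrix.vandermonde y).det := by
  classical
  let Q : Fin N → Polynomial K := fun j => ∏ l ∈ univ.erase j, (1 - Polynomial.X * Polynomial.C (y l))
  let E : Matrix (Fin N) (Fin N) K := Matrix.of fun k j => (Q j).coeff k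
  have hdeg : ∀ j, (Q j).natDegree < N := by
    intro j
    have h1 : (Q j).natDegree ≤ ∑ l ∈ univ.erase j, 1 := by
      refine (Polynomial.natDegree_prod_le _ _).trans (Finset.sum_le_sum fun l _ => ?_)
      compute_degree
    have h2 : ∑ l ∈ univ.erase j, 1 = N - 1 := by simp
    have := j.pos
    omega
  have key : ∀ z : Fin N → K, (Matrix.of fun i j => ∏ l ∈ univ.erase j, (1 - z i * y l)) =
      Matrix.vandermonde z * E := by
    intro z
    ext i j
    have h1 : ∏ l ∈ univ.erase j, (1 - z i * y l) = (Q j).eval (z i) := by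
      simp only [Q, Polynomial.eval_prod, Polynomial.eval_sub, Polynomial.eval_one,
        Polynomial.eval_mul, Polynomial.eval_X, Polynomial.eval_C]
    rw [Matrix.of_apply, h1, Polynomial.eval_eq_sum_range' (hdeg j), Matrix.mul_apply,
      ← Fin.sum_univ_eq_sum_range (fun k => (Q j).coeff k * z i ^ k)]
    refine Finset.sum_congr rfl fun k _ => ?_
    simp [E, Matrix.vandermonde_apply, mul_comm]
  have hE : E.det = (Matrix.vandermonde y).det := by
    have h1 := congrArg Matrix.det (key fun i => (y i)⁻¹)
    have h2 : (Matrix.of fun i j => ∏ l ∈ univ.erase j, (1 - (y i)⁻¹ * y l)) =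
        Matrix.diagonal fun j => ∏ l ∈ univ.erase j, (1 - (y j)⁻¹ * y l) := by
      ext i j
      by_cases h : i = j
      · subst h; simp
      · rw [Matrix.diagonal_apply_ne _ h, Matrix.of_apply]
        exact Finset.prod_eq_zero (mem_erase.2 ⟨h, mem_univ i⟩) (by simp [hy i])
    rw [h2, Matrix.det_diagonal, prod_prod_erase_eq, Matrix.det_mul] at h1
    have h3 : (Matrix.vandermonde fun i => (y i)⁻¹).det ≠ 0 :=
      Matrix.det_vandermonde_ne_zero_iff.2 (inv_injective.comp hinj)
    apply mul_left_cancel₀ h3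
    rw [← h1, Matrix.det_vandermonde, Matrix.det_vandermonde, ← Finset.prod_mul_distrib]
    refine Finset.prod_congr rfl fun i _ => ?_
    rw [← Finset.prod_mul_distrib]
    refine Finset.prod_congr rfl fun j _ => ?_
    have := hy i
    have := hy j
    field_simp
  rw [key, Matrix.det_mul, hE]

theorem det_cauchy {R : Type*} [CommRing R] [IsDomain R] (x y : Fin N → R)
    (hy : ∀ i, y i ≠ 0) (hinj : Function.Injective y) :
    (Matrix.of fun i j => ∏ l ∈ univ.erase j, (1 - x i * y l)).det =
      (Matrix.vandermonde x).det * (Matrix.vandermonde y).det := by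
  have transfer : ∀ {K : Type _} [Field K] (f : R →+* K), Function.Injective f →
      (Matrix.of fun i j => ∏ l ∈ univ.erase j, (1 - x i * y l)).det =
      (Matrix.vandermonde x).det * (Matrix.vandermonde y).det := by
    intro K _ f hf
    apply hf
    have h := det_cauchy_field (fun i => f (x i)) (fun i => f (y i))
      (fun i => by rw [Ne, map_eq_zero_iff f hf]; exact hy i) (fun i j hij => hinj (hf hij))
    rw [map_mul, RingHom.map_det, RingHom.map_det, RingHom.map_det]
    convert h using 3
    all_goals
      ext i j
      simp [Matrix.vandermonde_apply]
  exact transfer (algebraMap R (FractionRing R)) (IsFractionRing.injective _ _)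

end CauchyDeterminant

section CauchyCoefficients

variable {N : ℕ}

/-- The number of matrices of natural numbers with row sums `α` and column sums `γ`. -/
noncomputable def contingencyCount (α γ : Fin N → ℕ) : ℕ :=
  Nat.card {A : Fin N → Fin N → ℕ // (∀ i, ∑ j, A i j = α i) ∧ ∀ j, ∑ i, A i j = γ j}

/-- The exponent vector of the monomial `x ^ α * y ^ γ`. -/
noncomputable def biExp (α γ : Fin N → ℕ) : Fin N ⊕ Fin N →₀ ℕ :=
  Finsupp.equivFunOnFinite.symm (Sum.elim α γ)

@[simp] theorem biExp_inl (α γ : Fin N → ℕ) (i : Fin N) : biExp α γ (Sum.inl i) = α i := rfl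

@[simp] theorem biExp_inr (α γ : Fin N → ℕ) (i : Fin N) : biExp α γ (Sum.inr i) = γ i := rfl

/-- The exponent vector of the monomial `x i * y j`. -/
noncomputable def pairExp (i j : Fin N) : Fin N ⊕ Fin N →₀ ℕ :=
  Finsupp.single (Sum.inl i) 1 + Finsupp.single (Sum.inr j) 1

theorem pairExp_ne_zero (i j : Fin N) : pairExp i j ≠ 0 := by
  intro h
  have := DFunLike.congr_fun h (Sum.inl i)
  simp [pairExp] at this

theorem sum_smul_pairExp_eq_biExp_iff {P : Type*} [Fintype P] (r c : P → Fin N) (m : P → ℕ)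
    (α γ : Fin N → ℕ) :
    ∑ p, m p • pairExp (r p) (c p) = biExp α γ ↔
      (∀ i, ∑ p, (if r p = i then m p else 0) = α i) ∧
        ∀ j, ∑ p, (if c p = j then m p else 0) = γ j := by
  rw [DFunLike.ext_iff, Sum.forall]
  simp [pairExp, Finsupp.single_apply]

theorem coeff_prod_geomSeries_pairs (α γ : Fin N → ℕ) :
    MvPowerSeries.coeff (biExp α γ) (∏ p : Fin N × Fin N, geomSeries (pairExp p.1 p.2)) =
      contingencyCount α γ := by
  rw [coeff_prod_geomSeries (fun p : Fin N × Fin N => pairExp p.1 p.2)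
    fun p => pairExp_ne_zero p.1 p.2]
  norm_cast
  refine Nat.card_congr ((Equiv.curry _ _ _).subtypeEquiv fun m => ?_)
  rw [sum_smul_pairExp_eq_biExp_iff Prod.fst Prod.snd]
  simp only [Fintype.sum_prod_type, Function.curry, Equiv.curry_apply]
  refine and_congr (forall_congr' fun i => ?_) (forall_congr' fun j => ?_)
  · rw [Finset.sum_eq_single i] <;> simp +contextual
  · simp

theorem coeff_prod_geomSeries_perm (α γ : Fin N → ℕ) (σ : Equiv.Perm (Fin N)) :
    MvPowerSeries.coeff (biExp α γ) (∏ i, geomSeries (pairExp i (σ i))) =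
      if α = γ ∘ σ then 1 else 0 := by
  rw [coeff_prod_geomSeries _ fun i => pairExp_ne_zero i (σ i)]
  simp_rw [sum_smul_pairExp_eq_biExp_iff (fun i => i) σ]
  have h1 : ∀ (m : Fin N → ℕ) (j : Fin N),
      ∑ p, (if σ p = j then m p else 0) = m (σ.symm j) := by
    intro m j
    simp_rw [← Equiv.eq_symm_apply]
    simp
  simp_rw [h1]
  simp only [Finset.sum_ite_eq', mem_univ, if_true]
  split_ifs with h
  · rw [Nat.cast_eq_one, Nat.card_eq_one_iff_unique]
    refine ⟨⟨fun a b => Subtype.ext (funext fun i => ?_)⟩, ⟨α, fun _ => rfl, fun j => ?_⟩⟩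
    · rw [a.2.1, b.2.1]
    · simp [h]
  · rw [Nat.cast_eq_zero, Nat.card_eq_zero]
    refine Or.inl ⟨fun a => h (funext fun i => ?_)⟩
    rw [← a.2.1 i, Function.comp_apply, ← a.2.2 (σ i), Equiv.symm_apply_apply]

theorem det_geomSeries :
    (Matrix.vandermonde fun i : Fin N => (MvPowerSeries.X (Sum.inl i) : MvPowerSeries (Fin N ⊕ Fin N) ℤ)).det *
    (Matrix.vandermonde fun i : Fin N => (MvPowerSeries.X (Sum.inr i) : MvPowerSeries (Fin N ⊕ Fin N) ℤ)).det *
    (∏ p : Fin N × Fin N, geomSeries (pairExp p.1 p.2)) =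
    (Matrix.of fun i j : Fin N => geomSeries (pairExp i j)).det := by
  have hinv : ∀ i j : Fin N, geomSeries (pairExp i j) *
      (1 - MvPowerSeries.X (Sum.inl i) * MvPowerSeries.X (Sum.inr j)) = 1 := by
    intro i j
    have := geomSeries_mul (pairExp i j) (pairExp_ne_zero i j)
    rwa [pairExp, ← one_mul (1 : ℤ), ← MvPowerSeries.monomial_mul_monomial] at this
  have : IsDomain (MvPowerSeries (Fin N ⊕ Fin N) ℤ) := NoZeroDivisors.to_isDomain _
  rw [← det_cauchy]
  · have h1 : (Matrix.of fun i j : Fin N => ∏ l ∈ univ.erase j,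
        (1 - MvPowerSeries.X (Sum.inl i) * MvPowerSeries.X (Sum.inr l) :
          MvPowerSeries (Fin N ⊕ Fin N) ℤ)) =
      Matrix.of fun i j => (∏ l, (1 - MvPowerSeries.X (Sum.inl i) * MvPowerSeries.X (Sum.inr l))) *
        (Matrix.of fun i j : Fin N => geomSeries (pairExp i j)) i j := by
      ext i j : 2
      rw [Matrix.of_apply, Matrix.of_apply, Matrix.of_apply, ← Finset.mul_prod_erase _ _ (mem_univ j)]
      rw [mul_right_comm, mul_comm _ (geomSeries _), hinv, one_mul]
    rw [h1, Matrix.det_mul_column, Fintype.prod_prod_type, mul_right_comm, ← Finset.prod_mul_distrib]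
    simp_rw [← Finset.prod_mul_distrib, mul_comm _ (geomSeries _), hinv]
    simp
  · intro i h
    have := congrArg (MvPowerSeries.coeff (Finsupp.single (Sum.inr i) 1)) h
    simp [MvPowerSeries.coeff_X] at this
  · intro i j h
    have := congrArg (MvPowerSeries.coeff (Finsupp.single (Sum.inr i) 1)) h
    simp [MvPowerSeries.coeff_X, Finsupp.single_left_inj] at this
    exact this

end CauchyCoefficients

section AlternatingContingency

variable {N : ℕ}

theorem det_vandermonde_X_mul :
    (Matrix.vandermonde fun i : Fin N => (MvPowerSeries.X (Sum.inl i) : MvPowerSeries (Fin N ⊕ Fin N) ℤ)).det *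
    (Matrix.vandermonde fun i : Fin N => (MvPowerSeries.X (Sum.inr i) : MvPowerSeries (Fin N ⊕ Fin N) ℤ)).det =
    ∑ σ : Equiv.Perm (Fin N), ∑ τ : Equiv.Perm (Fin N),
      MvPowerSeries.monomial (biExp (fun i => (σ i : ℕ)) fun i => (τ i : ℕ))
        ((Equiv.Perm.sign σ : ℤ) * Equiv.Perm.sign τ) := by
  rw [← Matrix.det_transpose, ← Matrix.det_transpose (Matrix.vandermonde _), Matrix.det_apply',
    Matrix.det_apply', Finset.sum_mul_sum]
  refine Finset.sum_congr rfl fun σ _ => Finset.sum_congr rfl fun τ _ => ?_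
  have h1 : ∀ f : Fin N → Fin N ⊕ Fin N, ∀ e : Fin N → ℕ,
      ∏ i, (MvPowerSeries.X (f i) : MvPowerSeries (Fin N ⊕ Fin N) ℤ) ^ e i =
        MvPowerSeries.monomial (∑ i, Finsupp.single (f i) (e i)) 1 := by
    intro f e
    simp_rw [MvPowerSeries.X_pow_eq]
    rw [MvPowerSeries.prod_monomial]
    simp
  simp only [Matrix.transpose_apply, Matrix.vandermonde_apply]
  rw [h1, h1, mul_mul_mul_comm, MvPowerSeries.monomial_mul_monomial]
  have h2 : ∑ i, Finsupp.single (Sum.inl i : Fin N ⊕ Fin N) (σ i : ℕ) +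
      ∑ i, Finsupp.single (Sum.inr i : Fin N ⊕ Fin N) (τ i : ℕ) =
      biExp (fun i => (σ i : ℕ)) fun i => (τ i : ℕ) := by
    ext (i | i) <;> simp [Finsupp.single_apply]
  rw [h2]
  have h3 : ∀ (a : ℤ), (a : MvPowerSeries (Fin N ⊕ Fin N) ℤ) = MvPowerSeries.C a := fun a => by simp
  rw [h3, h3, ← map_mul, ← MvPowerSeries.monomial_zero_eq_C_apply, MvPowerSeries.monomial_mul_monomial]
  simp

theorem sum_sign_contingencyCount (β γ : Fin N → ℕ) (hβ : StrictMono β) (hγ : StrictMono γ) :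
    ∑ σ : Equiv.Perm (Fin N), ∑ τ : Equiv.Perm (Fin N),
      (if (∀ i, (σ i : ℕ) ≤ β i) ∧ ∀ i, (τ i : ℕ) ≤ γ i then
        (Equiv.Perm.sign σ : ℤ) * Equiv.Perm.sign τ *
          contingencyCount (fun i => β i - σ i) (fun i => γ i - τ i) else 0) =
      if β = γ then 1 else 0 := by
  have h := congrArg (MvPowerSeries.coeff (biExp β γ)) (det_geomSeries (N := N))
  rw [det_vandermonde_X_mul, Finset.sum_mul, map_sum] at h
  simp_rw [Finset.sum_mul, map_sum, MvPowerSeries.coeff_monomial_mul] at h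
  have e1 : ∀ σ τ : Equiv.Perm (Fin N), (biExp (fun i => (σ i : ℕ)) fun i => (τ i : ℕ)) ≤ biExp β γ ↔
      (∀ i, (σ i : ℕ) ≤ β i) ∧ ∀ i, (τ i : ℕ) ≤ γ i := by
    intro σ τ
    rw [Finsupp.le_def, Sum.forall]; rfl
  have e2 : ∀ σ τ : Equiv.Perm (Fin N),
      biExp β γ - (biExp (fun i => (σ i : ℕ)) fun i => (τ i : ℕ)) =
      biExp (fun i => β i - σ i) (fun i => γ i - τ i) := by
    intro σ τ
    ext (i | i) <;> rfl
  simp_rw [e1, e2, coeff_prod_geomSeries_pairs] at h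
  rw [h, ← Matrix.det_transpose, Matrix.det_apply', map_sum]
  have h3 : ∀ (a : ℤ), (a : MvPowerSeries (Fin N ⊕ Fin N) ℤ) = MvPowerSeries.C a := fun a => by simp
  simp_rw [h3, MvPowerSeries.coeff_C_mul, Matrix.transpose_apply, Matrix.of_apply, coeff_prod_geomSeries_perm]
  have e3 : ∀ σ : Equiv.Perm (Fin N), β = γ ∘ σ ↔ β = γ ∧ σ = 1 := by
    intro σ
    constructor
    · intro hs
      have : β = γ := by
        rw [← hβ.range_inj hγ, hs, Set.range_comp, σ.range_eq_univ, Set.image_univ]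
      refine ⟨this, Equiv.ext fun i => hγ.injective ?_⟩
      rw [← this, Equiv.Perm.one_apply]
      nth_rw 2 [hs]
      rw [this]; rfl
    · rintro ⟨rfl, rfl⟩; rfl
  simp_rw [e3]
  by_cases hb : β = γ <;> simp [hb]

end AlternatingContingency

section PermutationCharacter

/-- The permutation representation on functions. -/
noncomputable def permRep (G X : Type*) [Group G] [MulAction G X] : Representation ℂ G (X → ℂ) where
  toFun g := LinearMap.funLeft ℂ ℂ fun x => g⁻¹ • x
  map_one' := by ext f x; simp [LinearMap.funLeft]
  map_mul' g h := by
    apply LinearMap.ext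
    intro f
    funext x
    simp [LinearMap.funLeft, mul_smul]

theorem permRep_character {G X : Type*} [Group G] [MulAction G X] [Fintype X] (g : G) :
    (permRep G X).character g = Nat.card (MulAction.fixedBy X g) := by
  classical
  rw [Representation.character, LinearMap.trace_eq_matrix_trace ℂ (Pi.basisFun ℂ X), Matrix.trace]
  simp only [Matrix.diag_apply, LinearMap.toMatrix_apply, Pi.basisFun_repr, Pi.basisFun_apply]
  have : ∀ x : X, (permRep G X g (Pi.single x 1) : X → ℂ) x = if g • x = x then 1 else 0 := by
    intro x
    change (Pi.single x (1 : ℂ) : X → ℂ) (g⁻¹ • x) = _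
    rw [Pi.single_apply]
    simp only [inv_smul_eq_iff, eq_comm (a := x)]
  simp_rw [this]
  rw [Finset.sum_boole, Nat.card_eq_fintype_card, Fintype.card_subtype]
  rfl

theorem sum_character_mul_card_fixedBy {G X : Type} [Group G] [Fintype G] [MulAction G X] [Fintype X]
    (V : FDRep ℂ G) : ∃ m : ℕ, ∑ g : G, V.character g * (Nat.card (MulAction.fixedBy X g) : ℂ) =
      Nat.card G * m := by
  have : Invertible (Nat.card G : ℂ) := invertibleOfNonzero (by simp)
  have h := Representation.card_inv_mul_sum_char_mul_char_eq_finrank (permRep G X) V.ρ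
  refine ⟨Module.finrank ℂ ((permRep G X).IntertwiningMap V.ρ), ?_⟩
  · rw [← h, ← mul_assoc, mul_inv_cancel₀ (by simp), one_mul]
    refine Finset.sum_congr rfl fun g _ => ?_
    rw [permRep_character, MulAction.fixedBy_inv]
    rfl

end PermutationCharacter

section Words

/-- The words of length `n` in which the letter `i` occurs `α i` times. -/
def WordsOfContent (n : ℕ) {N : ℕ} (α : Fin N → ℕ) : Type :=
  {φ : Fin n → Fin N // ∀ i, Nat.card {k // φ k = i} = α i}

variable {n N : ℕ}

noncomputable instance (α : Fin N → ℕ) : Fintype (WordsOfContent n α) :=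
  open scoped Classical in inferInstanceAs (Fintype {_φ : Fin n → Fin N // _})

instance (α : Fin N → ℕ) : MulAction (Equiv.Perm (Fin n)) (WordsOfContent n α) where
  smul g φ := ⟨fun k => φ.1 (g⁻¹ k), fun i => by
    rw [← φ.2 i]
    exact Nat.card_congr (g⁻¹.subtypeEquiv fun k => Iff.rfl)⟩
  one_smul _ := rfl
  mul_smul _ _ _ := rfl

theorem WordsOfContent.smul_val (α : Fin N → ℕ) (g : Equiv.Perm (Fin n)) (φ : WordsOfContent n α) (k : Fin n) :
    (g • φ).1 k = φ.1 (g⁻¹ k) := rfl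

theorem exists_perm_comp_eq {ι κ : Type*} [Finite ι] (f f' : ι → κ)
    (h : ∀ k, Nat.card {i // f i = k} = Nat.card {i // f' i = k}) :
    ∃ g : Equiv.Perm ι, ∀ i, f' (g i) = f i := by
  have e : ∀ k, Nonempty ({i // f i = k} ≃ {i // f' i = k}) := fun k =>
    Finite.card_eq.1 (h k)
  let e := fun k => (e k).some
  refine ⟨(Equiv.sigmaFiberEquiv f).symm.trans
    ((Equiv.sigmaCongrRight fun k => (e k)).trans (Equiv.sigmaFiberEquiv f')), fun i => ?_⟩
  exact (e (f i) ⟨i, rfl⟩).2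

theorem exists_fun_card_fiber {κ : Type*} [Fintype κ] (n : ℕ) (c : κ → ℕ) (hc : ∑ k, c k = n) :
    ∃ f : Fin n → κ, ∀ k, Nat.card {i // f i = k} = c k := by
  have h : Nat.card (Fin n) = Nat.card (Σ k, Fin (c k)) := by
    rw [Nat.card_sigma]; simp [hc]
  let e : Fin n ≃ Σ k, Fin (c k) := (Finite.card_eq.1 h).some
  refine ⟨fun i => (e i).1, fun k => ?_⟩
  rw [Nat.card_congr ((e.subtypeEquiv fun i => Iff.rfl :
    {i // (e i).1 = k} ≃ {s : Σ k, Fin (c k) // s.1 = k}).trans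
    (Equiv.sigmaSubtype k))]
  simp

end Words

section WordCount

variable {n N : ℕ}

/-- The number of words of content `α` fixed by a permutation of the positions. -/
noncomputable def wordCount (α : Fin N → ℕ) (g : Equiv.Perm (Fin n)) : ℕ :=
  Nat.card (MulAction.fixedBy (WordsOfContent n α) g)

theorem wordCount_conj (α : Fin N → ℕ) (g h : Equiv.Perm (Fin n)) :
    wordCount α (h * g * h⁻¹) = wordCount α g := by
  have := Representation.char_conj (permRep (Equiv.Perm (Fin n)) (WordsOfContent n α)) g h
  rw [permRep_character, permRep_character] at this
  exact_mod_cast this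

theorem isPretransitive_wordsOfContent (α : Fin N → ℕ) :
    MulAction.IsPretransitive (Equiv.Perm (Fin n)) (WordsOfContent n α) := by
  refine ⟨fun φ χ => ?_⟩
  obtain ⟨g, hg⟩ := exists_perm_comp_eq φ.1 χ.1 fun k => (φ.2 k).trans (χ.2 k).symm
  refine ⟨g, Subtype.ext (funext fun k => ?_)⟩
  rw [WordsOfContent.smul_val, ← hg]
  simp

theorem wordCount_one_mul (α : Fin N → ℕ) (hα : ∑ i, α i = n) :
    wordCount α (1 : Equiv.Perm (Fin n)) * ∏ i, (α i).factorial = n.factorial := by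
  obtain ⟨f, hf⟩ := exists_fun_card_fiber n α hα
  let φ : WordsOfContent n α := ⟨f, hf⟩
  have := isPretransitive_wordsOfContent (n := n) α
  classical
  have h1 := MulAction.card_orbit_mul_card_stabilizer_eq_card_group (Equiv.Perm (Fin n)) φ
  rw [Fintype.card_perm, Fintype.card_fin] at h1
  simp_rw [← Nat.card_eq_fintype_card] at h1
  rw [← h1]
  congr 1
  · rw [wordCount, MulAction.fixedBy_one_eq_univ, MulAction.orbit_eq_univ]
  · have h2 := DomMulAct.stabilizer_card f
    simp_rw [← Nat.card_eq_fintype_card, hf] at h2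
    rw [← h2]
    refine Nat.card_congr ((Equiv.inv _).subtypeEquiv fun g => ?_)
    change f ∘ g = f ↔ g⁻¹ • φ = φ
    refine Iff.trans ?_ Subtype.ext_iff.symm
    rw [funext_iff, funext_iff]
    exact Iff.rfl

theorem sum_wordCount_mul_wordCount (α γ : Fin N → ℕ) (hα : ∑ i, α i = n) :
    ∑ g : Equiv.Perm (Fin n), wordCount α g * wordCount γ g =
      n.factorial * contingencyCount α γ := by
  classical
  have h1 := MulAction.sum_card_fixedBy_eq_card_orbits_mul_card_group (Equiv.Perm (Fin n))
    (WordsOfContent n α × WordsOfContent n γ)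
  rw [Fintype.card_perm, Fintype.card_fin, mul_comm] at h1
  simp_rw [← Nat.card_eq_fintype_card] at h1
  have h2 : ∀ g : Equiv.Perm (Fin n),
      Nat.card (MulAction.fixedBy (WordsOfContent n α × WordsOfContent n γ) g) =
        wordCount α g * wordCount γ g := by
    intro g
    rw [wordCount, wordCount, ← Nat.card_prod, ← Nat.card_congr (Equiv.Set.prod _ _)]
    congr 2
    ext x
    simp [Prod.ext_iff]
  simp_rw [h2] at h1
  rw [h1]
  congr 1
  let F : WordsOfContent n α × WordsOfContent n γ →
      {A : Fin N → Fin N → ℕ // (∀ i, ∑ j, A i j = α i) ∧ ∀ j, ∑ i, A i j = γ j} := fun x =>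
    ⟨fun i j => Nat.card {k // (x.1.1 k, x.2.1 k) = (i, j)}, fun i => by
      rw [← x.1.2 i]
      simp only [Prod.mk.injEq, Nat.card_eq_fintype_card, Fintype.card_subtype]
      rw [Finset.card_eq_sum_card_fiberwise (f := x.2.1) (t := univ) (by simp)]
      simp [Finset.filter_filter], fun j => by
      rw [← x.2.2 j]
      simp only [Prod.mk.injEq, Nat.card_eq_fintype_card, Fintype.card_subtype]
      rw [Finset.card_eq_sum_card_fiberwise (f := x.1.1) (t := univ) (by simp)]
      simp [Finset.filter_filter, and_comm]⟩
  have hF : ∀ x y, F x = F y ↔ MulAction.orbitRel (Equiv.Perm (Fin n)) _ x y := by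
    intro x y
    rw [MulAction.orbitRel_apply, MulAction.mem_orbit_iff]
    constructor
    · intro h
      obtain ⟨g, hg⟩ := exists_perm_comp_eq (fun k => (y.1.1 k, y.2.1 k))
        (fun k => (x.1.1 k, x.2.1 k))
        fun p => (congrFun (congrFun (congrArg Subtype.val h) p.1) p.2).symm
      refine ⟨g, Prod.ext (Subtype.ext (funext fun k => ?_)) (Subtype.ext (funext fun k => ?_))⟩
      · have := congrArg Prod.fst (hg (g⁻¹ k))
        simpa [WordsOfContent.smul_val] using this.symm
      · have := congrArg Prod.snd (hg (g⁻¹ k))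
        simpa [WordsOfContent.smul_val] using this.symm
    · rintro ⟨g, rfl⟩
      refine Subtype.ext (funext fun i => funext fun j => ?_)
      exact Nat.card_congr (g⁻¹.subtypeEquiv fun k => Iff.rfl)
  refine Nat.card_congr (Equiv.ofBijective
    (Quotient.lift F fun x y h => (hF x y).2 h) ⟨?_, ?_⟩)
  · rintro ⟨x⟩ ⟨y⟩ h
    exact Quotient.sound ((hF x y).1 h)
  · rintro ⟨A, hA⟩
    obtain ⟨f, hf⟩ := exists_fun_card_fiber n (fun p : Fin N × Fin N => A p.1 p.2) (by
      rw [Fintype.sum_prod_type, ← hα]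
      exact Finset.sum_congr rfl fun i _ => hA.1 i)
    refine ⟨Quotient.mk _ (⟨fun k => (f k).1, fun i => ?_⟩, ⟨fun k => (f k).2, fun j => ?_⟩), ?_⟩
    · rw [← hA.1 i, Nat.card_eq_fintype_card, Fintype.card_subtype,
        Finset.card_eq_sum_card_fiberwise (f := fun k => (f k).2) (t := univ) (by simp)]
      refine Finset.sum_congr rfl fun j _ => ?_
      rw [← hf (i, j), Nat.card_eq_fintype_card, Fintype.card_subtype, Finset.filter_filter]
      simp only [Prod.ext_iff]
    · rw [← hA.2 j, Nat.card_eq_fintype_card, Fintype.card_subtype,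
        Finset.card_eq_sum_card_fiberwise (f := fun k => (f k).1) (t := univ) (by simp)]
      refine Finset.sum_congr rfl fun i _ => ?_
      rw [← hf (i, j), Nat.card_eq_fintype_card, Fintype.card_subtype, Finset.filter_filter]
      simp only [Prod.ext_iff, and_comm]
    · exact Subtype.ext (funext fun i => funext fun j => hf (i, j))

end WordCount

section AlternatingCharacter

variable {n N : ℕ}

/-- The alternating sum of permutation characters given by the Jacobi-Trudi formula. -/
noncomputable def altChar (β : Fin N → ℕ) (g : Equiv.Perm (Fin n)) : ℤ :=
  ∑ w : Equiv.Perm (Fin N), if ∀ i, (w i : ℕ) ≤ β i then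
    (Equiv.Perm.sign w : ℤ) * wordCount (fun i => β i - w i) g else 0

theorem altChar_conj (β : Fin N → ℕ) (g h : Equiv.Perm (Fin n)) :
    altChar β (h * g * h⁻¹) = altChar β g := by
  simp only [altChar, wordCount_conj]

theorem sum_sub_perm (β : Fin N → ℕ) (hβ : ∑ i, β i = n + ∑ i : Fin N, (i : ℕ))
    (w : Equiv.Perm (Fin N)) (hw : ∀ i, (w i : ℕ) ≤ β i) : ∑ i, (β i - w i) = n := by
  rw [Finset.sum_tsub_distrib _ fun i _ => hw i, hβ, Equiv.sum_comp w fun i => (i : ℕ)]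
  simp

theorem sum_altChar_mul_altChar (β γ : Fin N → ℕ) (hβ : StrictMono β) (hγ : StrictMono γ)
    (hβ' : ∑ i, β i = n + ∑ i : Fin N, (i : ℕ)) :
    ∑ g : Equiv.Perm (Fin n), altChar β g * altChar γ g =
      n.factorial * if β = γ then 1 else 0 := by
  rw [← sum_sign_contingencyCount β γ hβ hγ]
  simp_rw [altChar, Finset.sum_mul_sum]
  rw [Finset.sum_comm, Finset.mul_sum]
  refine Finset.sum_congr rfl fun σ _ => ?_
  rw [Finset.sum_comm, Finset.mul_sum]
  refine Finset.sum_congr rfl fun τ _ => ?_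
  by_cases h1 : ∀ i, (σ i : ℕ) ≤ β i
  · by_cases h2 : ∀ i, (τ i : ℕ) ≤ γ i
    · simp_rw [if_pos h1, if_pos h2, if_pos (And.intro h1 h2)]
      have := sum_wordCount_mul_wordCount (fun i => β i - σ i) (fun i => γ i - τ i)
        (sum_sub_perm β hβ' σ h1)
      zify at this
      rw [mul_left_comm, ← this, Finset.mul_sum]
      refine Finset.sum_congr rfl fun g _ => ?_
      ring
    · simp [h2]
  · simp [h1]

theorem sum_character_mul_altChar (V : FDRep ℂ (Equiv.Perm (Fin n))) (β : Fin N → ℕ) :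
    ∃ m : ℤ, ∑ g, V.character g * (altChar β g : ℂ) = n.factorial * m := by
  choose m hm using fun w : Equiv.Perm (Fin N) =>
    sum_character_mul_card_fixedBy (X := WordsOfContent n fun i => β i - w i) V
  refine ⟨∑ w : Equiv.Perm (Fin N), if ∀ i, (w i : ℕ) ≤ β i then
    (Equiv.Perm.sign w : ℤ) * m w else 0, ?_⟩
  simp_rw [altChar, Int.cast_sum, Finset.mul_sum]
  rw [Finset.sum_comm]
  refine Finset.sum_congr rfl fun w _ => ?_
  split_ifs with h
  · have := hm w
    rw [Nat.card_eq_fintype_card, Fintype.card_perm, Fintype.card_fin] at this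
    push_cast
    rw [mul_left_comm, ← this, Finset.mul_sum]
    refine Finset.sum_congr rfl fun g _ => ?_
    rw [wordCount]
    ring
  · simp

end AlternatingCharacter

section PartitionBeta

variable {n : ℕ}

/-- The parts of a partition of `n`, padded by zeros to length `n`, in increasing order. -/
def paddedParts (μ : n.Partition) : List ℕ :=
  (μ.parts + Multiset.replicate (n - μ.parts.card) 0).sort (· ≤ ·)

theorem length_paddedParts (μ : n.Partition) : (paddedParts μ).length = n := by
  have h : μ.parts.card ≤ n := by
    have := Multiset.card_nsmul_le_sum (s := μ.parts) (a := 1) fun x hx => μ.parts_pos hx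
    rw [μ.parts_sum] at this
    simpa using this
  simp [paddedParts, h]

theorem sum_paddedParts (μ : n.Partition) : (paddedParts μ).sum = n := by
  rw [← Multiset.sum_coe, paddedParts, Multiset.sort_eq]
  simp [μ.parts_sum]

theorem paddedParts_injective : Function.Injective (paddedParts (n := n)) := by
  intro μ ν h
  have h1 := congrArg (fun l : List ℕ => Multiset.filter (· ≠ 0) (l : Multiset ℕ)) h
  simp only [paddedParts, Multiset.sort_eq, Multiset.filter_add] at h1
  have h2 : ∀ k, Multiset.filter (· ≠ 0) (Multiset.replicate k 0) = 0 := by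
    intro k
    rw [Multiset.filter_eq_nil]
    intro a ha
    simp [Multiset.eq_of_mem_replicate ha]
  have h3 : ∀ μ : n.Partition, Multiset.filter (· ≠ 0) μ.parts = μ.parts := fun μ =>
    Multiset.filter_eq_self.2 fun a ha => (μ.parts_pos ha).ne'
  rw [h2, h2, h3, h3, add_zero, add_zero] at h1
  exact Nat.Partition.ext h1

/-- The beta-numbers of a partition, in increasing order. -/
def betaNumbers (μ : n.Partition) (i : Fin n) : ℕ :=
  i + (paddedParts μ)[i]'(by rw [length_paddedParts]; exact i.2)

theorem betaNumbers_strictMono (μ : n.Partition) : StrictMono (betaNumbers μ) := by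
  intro i j h
  have h1 : (paddedParts μ).Pairwise (· ≤ ·) := Multiset.pairwise_sort _ _
  have h2 := List.pairwise_iff_getElem.1 h1 i j (by rw [length_paddedParts]; exact i.2)
    (by rw [length_paddedParts]; exact j.2) h
  exact add_lt_add_of_lt_of_le h h2

theorem sum_betaNumbers (μ : n.Partition) :
    ∑ i, betaNumbers μ i = n + ∑ i : Fin n, (i : ℕ) := by
  simp_rw [betaNumbers]
  rw [Finset.sum_add_distrib, add_comm]
  congr 1
  conv_rhs => rw [← sum_paddedParts μ, ← Fin.sum_univ_getElem]
  exact Fintype.sum_equiv (finCongr (length_paddedParts μ).symm) _ _ fun i => rfl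

theorem betaNumbers_injective : Function.Injective (betaNumbers (n := n)) := by
  intro μ ν h
  apply paddedParts_injective
  refine List.ext_getElem (by rw [length_paddedParts, length_paddedParts]) fun i h1 h2 => ?_
  rw [length_paddedParts] at h1
  have := congrFun h ⟨i, h1⟩
  simpa [betaNumbers] using this

end PartitionBeta

section IrreducibleCharacters

variable {n : ℕ}

/-- The conjugacy class of a permutation, as a partition of `n`. -/
def cyclePartition (g : Equiv.Perm (Fin n)) : n.Partition :=
  (Nat.Partition.ofSums n g.partition.parts (by rw [g.partition.parts_sum, Fintype.card_fin]))

theorem cyclePartition_eq_iff {g h : Equiv.Perm (Fin n)} :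
    cyclePartition g = cyclePartition h ↔ IsConj g h := by
  rw [Equiv.Perm.partition_eq_of_isConj, Nat.Partition.ext_iff, Nat.Partition.ext_iff,
    cyclePartition, cyclePartition]
  simp only [Nat.Partition.ofSums_parts]
  have h3 : ∀ g : Equiv.Perm (Fin n), Multiset.filter (· ≠ 0) g.partition.parts = g.partition.parts :=
    fun g => Multiset.filter_eq_self.2 fun a ha => (g.partition.parts_pos ha).ne'
  rw [h3, h3]

theorem sum_eq_sum_partition (F : n.Partition → ℂ) :
    ∑ g : Equiv.Perm (Fin n), F (cyclePartition g) =
      ∑ l, (#{g : Equiv.Perm (Fin n) | cyclePartition g = l} : ℂ) * F l := by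
  rw [← Finset.sum_fiberwise (g := cyclePartition)]
  refine Finset.sum_congr rfl fun l _ => ?_
  rw [Finset.sum_congr rfl fun g hg => by rw [(mem_filter.1 hg).2]]
  simp

theorem exists_factor_cyclePartition (f : Equiv.Perm (Fin n) → ℂ)
    (hf : ∀ g h, f (h * g * h⁻¹) = f g) : ∃ F : n.Partition → ℂ, ∀ g, f g = F (cyclePartition g) := by
  refine ⟨Function.extend cyclePartition f fun _ => 0, fun g => ?_⟩
  refine (Function.FactorsThrough.extend_apply (fun a b hab => ?_) _ g).symm
  obtain ⟨c, rfl⟩ := isConj_iff.1 (cyclePartition_eq_iff.1 hab)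
  exact (hf _ _).symm

theorem eq_sum_altChar (f : Equiv.Perm (Fin n) → ℂ) (hf : ∀ g h, f (h * g * h⁻¹) = f g)
    (g : Equiv.Perm (Fin n)) :
    n.factorial * f g = ∑ μ : n.Partition,
      (∑ h, f h * (altChar (betaNumbers μ) h : ℂ)) * altChar (betaNumbers μ) g := by
  classical
  obtain ⟨F, hF⟩ := exists_factor_cyclePartition f hf
  choose X hX using fun μ : n.Partition => exists_factor_cyclePartition
    (fun g => (altChar (betaNumbers μ) g : ℂ)) fun g h => by rw [altChar_conj]
  let c : n.Partition → ℂ := fun l => (#{g : Equiv.Perm (Fin n) | cyclePartition g = l} : ℂ)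
  have hn : (n.factorial : ℂ) ≠ 0 := by exact_mod_cast n.factorial_ne_zero
  let A : Matrix n.Partition n.Partition ℂ := Matrix.of fun μ l => X μ l * c l / n.factorial
  let B : Matrix n.Partition n.Partition ℂ := Matrix.of fun l μ => X μ l
  have hAB : A * B = 1 := by
    ext μ ν
    have h := sum_altChar_mul_altChar (betaNumbers μ) (betaNumbers ν) (betaNumbers_strictMono μ)
      (betaNumbers_strictMono ν) (sum_betaNumbers μ)
    have h1 := congrArg (fun z : ℤ => (z : ℂ)) h
    push_cast at h1
    simp_rw [hX] at h1
    rw [sum_eq_sum_partition (fun l => X μ l * X ν l)] at h1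
    rw [Matrix.mul_apply, Matrix.one_apply]
    simp only [A, B, Matrix.of_apply]
    simp_rw [betaNumbers_injective.eq_iff] at h1
    rw [← mul_right_inj' hn, ← h1, Finset.mul_sum]
    refine Finset.sum_congr rfl fun l _ => ?_
    simp only [c]
    field_simp
  have hBA : B * A = 1 := mul_eq_one_comm.1 hAB
  have h2 : (B * A).mulVec F = F := by rw [hBA, Matrix.one_mulVec]
  rw [← Matrix.mulVec_mulVec] at h2
  have h3 := congrFun h2 (cyclePartition g)
  rw [hF g, ← h3, Matrix.mulVec, dotProduct, Finset.mul_sum]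
  refine Finset.sum_congr rfl fun μ _ => ?_
  simp only [A, B, Matrix.of_apply, Matrix.mulVec, dotProduct]
  simp_rw [hX, hF]
  rw [sum_eq_sum_partition (fun l => F l * X μ l), Finset.mul_sum, Finset.mul_sum, Finset.sum_mul]
  refine Finset.sum_congr rfl fun l _ => ?_
  simp only [c]
  field_simp

theorem isConj_inv (g : Equiv.Perm (Fin n)) : IsConj g g⁻¹ := by
  rw [Equiv.Perm.isConj_iff_cycleType_eq, Equiv.Perm.cycleType_inv]

theorem sum_character_mul_self (V : FDRep ℂ (Equiv.Perm (Fin n))) [Simple V] :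
    ∑ g, V.character g * V.character g = n.factorial := by
  have hc : (Nat.card (Equiv.Perm (Fin n)) : ℂ) = n.factorial := by
    rw [Nat.card_eq_fintype_card, Fintype.card_perm, Fintype.card_fin]
  have hn : (Nat.card (Equiv.Perm (Fin n)) : ℂ) ≠ 0 := by
    rw [hc]; exact_mod_cast n.factorial_ne_zero
  have : Invertible (Nat.card (Equiv.Perm (Fin n)) : ℂ) := invertibleOfNonzero hn
  have h := FDRep.char_orthonormal V V
  rw [if_pos ⟨Iso.refl V⟩, inv_mul_eq_iff_eq_mul₀ hn, mul_one, hc] at h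
  rw [← h]
  refine Finset.sum_congr rfl fun g _ => ?_
  obtain ⟨c, hc⟩ := isConj_iff.1 (isConj_inv g)
  rw [← hc, FDRep.char_conj]

theorem exists_natAbs_altChar_eq_finrank (V : FDRep ℂ (Equiv.Perm (Fin n))) [Simple V] :
    ∃ μ : n.Partition, (altChar (betaNumbers μ) (1 : Equiv.Perm (Fin n))).natAbs =
      Module.finrank ℂ V := by
  classical
  have hn : (n.factorial : ℂ) ≠ 0 := by exact_mod_cast n.factorial_ne_zero
  choose a ha using fun μ : n.Partition => sum_character_mul_altChar V (betaNumbers μ)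
  have h1 : ∀ g, V.character g = ∑ μ, (a μ : ℂ) * altChar (betaNumbers μ) g := by
    intro g
    have := eq_sum_altChar V.character (fun g h => FDRep.char_conj V g h) g
    simp_rw [ha, mul_assoc] at this
    rw [← Finset.mul_sum] at this
    exact mul_left_cancel₀ hn this
  have h2 : ∑ μ, a μ * a μ = 1 := by
    have h := sum_character_mul_self V
    rw [Finset.sum_congr rfl fun g _ => congrArg (V.character g * ·) (h1 g)] at h
    simp_rw [Finset.mul_sum] at h
    rw [Finset.sum_comm] at h
    simp_rw [mul_left_comm _ (a _ : ℂ), ← Finset.mul_sum, ha,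
      mul_left_comm _ (n.factorial : ℂ)] at h
    rw [← Finset.mul_sum] at h
    have h' := mul_left_cancel₀ hn (h.trans (mul_one _).symm)
    exact_mod_cast h'
  obtain ⟨μ, hμ⟩ : ∃ μ, a μ ≠ 0 := by
    by_contra! h
    simp [h] at h2
  rw [← Finset.add_sum_erase _ _ (mem_univ μ)] at h2
  have h3 : 0 < a μ * a μ := mul_self_pos.2 hμ
  have h4 : ∀ ν ∈ univ.erase μ, 0 ≤ a ν * a ν := fun ν _ => mul_self_nonneg _
  have h5 : ∑ ν ∈ univ.erase μ, a ν * a ν = 0 :=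
    le_antisymm (by linarith) (Finset.sum_nonneg h4)
  have h6 : a μ * a μ = 1 := by linarith
  rw [Finset.sum_eq_zero_iff_of_nonneg h4] at h5
  refine ⟨μ, ?_⟩
  have h7 := h1 1
  rw [FDRep.char_one, ← Finset.add_sum_erase _ _ (mem_univ μ), Finset.sum_eq_zero (s := univ.erase μ)
    fun ν hν => by rw [mul_self_eq_zero.1 (h5 ν hν)]; simp, add_zero] at h7
  have h8 : (Module.finrank ℂ V : ℤ) = a μ * altChar (betaNumbers μ) (1 : Equiv.Perm (Fin n)) := by exact_mod_cast h7
  have h9 := congrArg Int.natAbs h8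
  rw [Int.natAbs_mul, Int.natAbs_natCast] at h9
  rw [h9]
  rcases mul_self_eq_one_iff.1 h6 with h | h <;> simp [h]

end IrreducibleCharacters

section HookProduct

/-- The product of the hook lengths of the partition with set of beta-numbers `H`. -/
def hookProd (H : Finset ℕ) : ℕ := ∏ x ∈ H, ∏ y ∈ range x \ H, (x - y)

/-- The size of the partition with set of beta-numbers `H`. -/
def betaSize (H : Finset ℕ) : ℕ := ∑ x ∈ H, #(range x \ H)

variable {n N : ℕ}

theorem altChar_one_mul_prod_factorial (β : Fin N → ℕ)
    (hβ : ∑ i, β i = n + ∑ i : Fin N, (i : ℕ)) :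
    altChar β (1 : Equiv.Perm (Fin n)) * ∏ i, ((β i).factorial : ℤ) =
      n.factorial * ∏ i, ∏ j ∈ Ioi i, ((β j : ℤ) - β i) := by
  have h := Matrix.det_eval_matrixOfPolynomials_eq_det_vandermonde (fun i ↦ (β i : ℤ))
      (fun i => descPochhammer ℤ i)
      (fun i => descPochhammer_natDegree ℤ i)
      (fun i => monic_descPochhammer ℤ i)
  rw [Matrix.det_vandermonde] at h
  rw [h, ← Matrix.det_transpose, Matrix.det_apply', altChar, Finset.sum_mul, Finset.mul_sum]
  refine Finset.sum_congr rfl fun w _ => ?_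
  simp only [Matrix.transpose_apply, Matrix.of_apply, descPochhammer_eval_eq_descFactorial]
  split_ifs with hw
  · have h1 := wordCount_one_mul (fun i => β i - w i) (sum_sub_perm β hβ w hw)
    zify at h1
    have h2 : ∏ i, ((β i).factorial : ℤ) = (∏ i, ((β i - w i).factorial : ℤ)) *
        ∏ i, ((β i).descFactorial (w i) : ℤ) := by
      rw [← Finset.prod_mul_distrib]
      refine Finset.prod_congr rfl fun i _ => ?_
      exact_mod_cast (Nat.factorial_mul_descFactorial (hw i)).symm
    rw [← h1, h2, Int.cast_id]
    ring
  · push Not at hw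
    obtain ⟨i, hi⟩ := hw
    have h2 : ∏ i, ((β i).descFactorial (w i) : ℤ) = 0 :=
      Finset.prod_eq_zero (mem_univ i) (by rw [Nat.descFactorial_of_lt hi, Nat.cast_zero])
    rw [h2]
    simp

theorem range_inter_image {β : Fin N → ℕ} (hβ : StrictMono β) (j : Fin N) :
    range (β j) ∩ univ.image β = (Iio j).image β := by
  ext x
  simp only [mem_inter, mem_range, mem_image, mem_univ, true_and, mem_Iio]
  constructor
  · rintro ⟨h, i, rfl⟩
    exact ⟨i, hβ.lt_iff_lt.1 h, rfl⟩
  · rintro ⟨i, hi, rfl⟩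
    exact ⟨hβ hi, i, rfl⟩

theorem betaSize_image_add {β : Fin N → ℕ} (hβ : StrictMono β) :
    betaSize (univ.image β) + ∑ i : Fin N, (i : ℕ) = ∑ i, β i := by
  rw [betaSize, Finset.sum_image hβ.injective.injOn, ← Finset.sum_add_distrib]
  refine Finset.sum_congr rfl fun j _ => ?_
  have h := Finset.card_sdiff_add_card_inter (range (β j)) (univ.image β)
  rw [range_inter_image hβ, Finset.card_image_of_injective _ hβ.injective] at h
  simpa using h

theorem prod_factorial_image {β : Fin N → ℕ} (hβ : StrictMono β) :
    ∏ i, ((β i).factorial : ℤ) =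
      hookProd (univ.image β) * ∏ i, ∏ j ∈ Ioi i, ((β j : ℤ) - β i) := by
  rw [Finset.prod_comm' (t' := univ) (s' := fun j => Iio j) (by simp), hookProd,
    Finset.prod_image hβ.injective.injOn, Nat.cast_prod, ← Finset.prod_mul_distrib]
  refine Finset.prod_congr rfl fun j _ => ?_
  have h1 : (β j).factorial = ∏ y ∈ range (β j), (β j - y) := by
    rw [← Nat.descFactorial_self, Nat.descFactorial_eq_prod_range]
  rw [h1, ← Finset.prod_inter_mul_prod_sdiff (range (β j)) (univ.image β), mul_comm,
    range_inter_image hβ, Finset.prod_image hβ.injective.injOn, Nat.cast_mul]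
  congr 1
  rw [Nat.cast_prod]
  refine Finset.prod_congr rfl fun i hi => ?_
  rw [Nat.cast_sub (hβ (mem_Iio.1 hi)).le]

theorem altChar_one_mul_hookProd {β : Fin N → ℕ} (hβ : StrictMono β)
    (hβ' : ∑ i, β i = n + ∑ i : Fin N, (i : ℕ)) :
    altChar β (1 : Equiv.Perm (Fin n)) * hookProd (univ.image β) = n.factorial := by
  have h := altChar_one_mul_prod_factorial β hβ'
  rw [prod_factorial_image hβ, ← mul_assoc] at h
  refine mul_right_cancel₀ (Finset.prod_ne_zero_iff.2 fun i _ => Finset.prod_ne_zero_iff.2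
    fun j hj => ?_) h
  have := hβ (mem_Ioi.1 hj)
  omega

theorem hookProd_dvd_factorial (H : Finset ℕ) : hookProd H ∣ (betaSize H).factorial := by
  have hβ := (H.orderEmbOfFin rfl).strictMono
  have hH : univ.image (H.orderEmbOfFin rfl) = H := by simp
  have h1 := betaSize_image_add hβ
  have h2 := altChar_one_mul_hookProd (n := betaSize H) hβ (by rw [← h1, hH])
  rw [hH] at h2
  exact Int.natCast_dvd_natCast.1 ⟨_, by rw [← h2, mul_comm]⟩

theorem exists_finrank_mul_hookProd (V : FDRep ℂ (Equiv.Perm (Fin n))) [Simple V] :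
    ∃ H : Finset ℕ, betaSize H = n ∧ Module.finrank ℂ V * hookProd H = n.factorial := by
  obtain ⟨μ, hμ⟩ := exists_natAbs_altChar_eq_finrank V
  have hβ := betaNumbers_strictMono μ
  refine ⟨univ.image (betaNumbers μ), ?_, ?_⟩
  · have := betaSize_image_add hβ
    rw [sum_betaNumbers] at this
    omega
  · have h := congrArg Int.natAbs (altChar_one_mul_hookProd hβ (sum_betaNumbers μ))
    rw [Int.natAbs_mul, Int.natAbs_natCast, Int.natAbs_natCast, hμ] at h
    exact h

end HookProduct

section FiniteSearch

/-- The product of the differences between the members of a list and `b`. -/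
def listDiffProd (b : ℕ) : List ℕ → ℕ
  | [] => 1
  | x :: l => (x - b) * listDiffProd b l

/-- The product of all differences between later and earlier members of a list. -/
def listVandermonde : List ℕ → ℕ
  | [] => 1
  | x :: l => listDiffProd x l * listVandermonde l

/-- The product of the factorials of the members of a list. -/
def listFactorialProd : List ℕ → ℕ
  | [] => 1
  | x :: l => x.factorial * listFactorialProd l

/-- Either `D` has two distinct prime divisors, or `n` and `D` are as in the classification. -/
def degreeTest (n : ℕ) : ℕ → Bool
  | 0 => true
  | D + 1 =>
    Nat.ble 2 ([2, 3, 5, 7, 11, 13].countP fun q => (D + 1) % q == 0) || D == 0 || n == D + 2 ||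
      (n == 4 && D == 1) || (n == 5 && D == 4) || (n == 6 && (D == 8 || D == 15)) ||
      (n == 8 && D == 63) || (n == 9 && D == 26)

/-- Test all sets of `i` positive integers below `b` with sum `s`, together with those in `l`. -/
def searchTest (n F : ℕ) : ℕ → ℕ → ℕ → List ℕ → Bool
  | 0, 0, _, l => degreeTest n (F * listVandermonde l / listFactorialProd l)
  | 0, _ + 1, _, _ => true
  | _ + 1, 0, _, l => degreeTest n (F * listVandermonde l / listFactorialProd l)
  | _ + 1, _ + 1, 0, _ => true
  | b + 1, i + 1, s + 1, l =>
    Nat.blt (2 * (s + 1)) ((i + 1) * (i + 2)) ||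
      Nat.blt (2 * (i + 1) * (b + 1)) (2 * (s + 1) + (i + 1) * (i + 2)) ||
      (searchTest n F b (i + 1) (s + 1) l &&
        (Nat.blt (s + 1) b || searchTest n F b i (s + 1 - b) (b :: l)))

/-- The product of the numbers `r * (i + 1) + k` for `i < r`. -/
def shiftedProd (r k : ℕ) : ℕ := ∏ i ∈ range r, (r * (i + 1) + k)

/-- Either the degree bound excludes `(r, k)`, or the exhaustive search does. -/
def pairTest (r k : ℕ) : Bool :=
  Nat.blt ((r + k) * (k + (min k r - 1)) * 2 ^ (min k r - 2) * shiftedProd r k)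
    ((r + k).descFactorial r * r ^ r) ||
  searchTest (r + k) (r + k).factorial (2 * r) r (k + r * (r + 1) / 2) []

/-- Run `pairTest r` on the `m` numbers starting from `2`. -/
def rowTest (r : ℕ) : ℕ → Bool
  | 0 => true
  | m + 1 => pairTest r (m + 2) && rowTest r m

end FiniteSearch

section Normalization

/-- The multiset of hook lengths of the partition with set of beta-numbers `H`. -/
def hookLengths (H : Finset ℕ) : Multiset ℕ := ∑ x ∈ H, ∑ y ∈ range x \ H, {x - y}

theorem prod_hookLengths (H : Finset ℕ) : (hookLengths H).prod = hookProd H := by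
  simp [hookLengths, hookProd, Multiset.prod_sum]

theorem card_hookLengths (H : Finset ℕ) : (hookLengths H).card = betaSize H := by
  simp [hookLengths, betaSize, Multiset.card_sum]

theorem hookLengths_insert_zero_image_succ (H : Finset ℕ) :
    hookLengths (insert 0 (H.image Nat.succ)) = hookLengths H := by
  rw [hookLengths, Finset.sum_insert (by simp), range_zero, empty_sdiff, Finset.sum_empty,
    zero_add, Finset.sum_image Nat.succ_injective.injOn, hookLengths]
  refine Finset.sum_congr rfl fun x _ => ?_
  have h : range x.succ \ insert 0 (H.image Nat.succ) = (range x \ H).image Nat.succ := by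
    ext y
    cases y <;> simp
  rw [h, Finset.sum_image Nat.succ_injective.injOn]
  simp

theorem exists_zero_notMem_hookLengths_eq (m : ℕ) :
    ∀ H : Finset ℕ, #H = m → ∃ K : Finset ℕ, 0 ∉ K ∧ hookLengths K = hookLengths H := by
  induction m with
  | zero =>
    intro H hH
    exact ⟨H, by simp [card_eq_zero.1 hH], rfl⟩
  | succ m ih =>
    intro H hH
    by_cases h0 : 0 ∈ H
    · have h1 : insert 0 (((H.erase 0).image Nat.pred).image Nat.succ) = H := by
        rw [Finset.image_image, Finset.image_congr (g := id), image_id, insert_erase h0]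
        intro x hx
        have : x ≠ 0 := by simp at hx; exact hx.2
        simp only [Function.comp, id]
        exact Nat.succ_pred this
      have h2 : #((H.erase 0).image Nat.pred) = m := by
        rw [card_image_of_injOn, card_erase_of_mem h0, hH, Nat.add_sub_cancel]
        intro x hx y hy hxy
        simp at hx hy hxy
        omega
      obtain ⟨K, hK, hK'⟩ := ih _ h2
      exact ⟨K, hK, by rw [hK', ← h1, hookLengths_insert_zero_image_succ, h1]⟩
    · exact ⟨H, h0, rfl⟩

theorem hookLengths_image_range_sdiff {H : Finset ℕ} {M : ℕ} (hH : ∀ x ∈ H, x ≤ M) :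
    hookLengths ((range (M + 1) \ H).image (M - ·)) = hookLengths H := by
  have hinj : Set.InjOn (M - ·) (range (M + 1) \ H : Finset ℕ) := by
    intro x hx y hy hxy
    simp at hx hy hxy
    omega
  rw [hookLengths, Finset.sum_image hinj, hookLengths,
    Finset.sum_comm' (s := H) (t' := range (M + 1) \ H) (s' := fun y => H.filter (y < ·))]
  · refine Finset.sum_congr rfl fun y hy => ?_
    refine Finset.sum_nbij' (M - ·) (M - ·) ?_ ?_ ?_ ?_ ?_
    · intro z hz
      simp only [mem_sdiff, mem_range, mem_image, not_exists, not_and, mem_filter] at hz ⊢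
      refine ⟨?_, by omega⟩
      by_contra h
      exact hz.2 (M - z) ⟨by omega, h⟩ (by omega)
    · intro x hx
      simp only [mem_sdiff, mem_range, mem_image, not_exists, not_and, mem_filter] at hx hy ⊢
      have := hH x hx.1
      refine ⟨by omega, fun w hw hw' => hw.2 ?_⟩
      have : w = x := by omega
      rw [this]
      exact hx.1
    · intro z hz
      simp only [mem_sdiff, mem_range] at hz hy
      omega
    · intro x hx
      have := hH x (mem_filter.1 hx).1
      omega
    · intro z hz
      simp only [mem_sdiff, mem_range] at hz hy
      congr 1
      omega
  · intro x y
    simp only [mem_sdiff, mem_range, mem_filter]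
    constructor
    · rintro ⟨h1, h2, h3⟩
      have := hH x h1
      exact ⟨⟨h1, h2⟩, by omega, h3⟩
    · rintro ⟨⟨h1, h2⟩, h3, h4⟩
      exact ⟨h1, h2, h4⟩

theorem exists_normalized_hookLengths_eq (H : Finset ℕ) :
    ∃ K : Finset ℕ, 0 ∉ K ∧ (∀ x ∈ K, x < 2 * #K) ∧ hookLengths K = hookLengths H := by
  obtain ⟨K, hK, hKH⟩ := exists_zero_notMem_hookLengths_eq _ H rfl
  rw [← hKH]
  clear hKH
  obtain rfl | hne := K.eq_empty_or_nonempty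
  · exact ⟨∅, by simp⟩
  set M := K.max' hne with hM
  have hle : ∀ x ∈ K, x ≤ M := fun x hx => K.le_max' x hx
  have hmem : M ∈ K := K.max'_mem hne
  have hsub : K ⊆ range (M + 1) := fun x hx => by
    have := hle x hx
    rw [mem_range]; omega
  by_cases h : M < 2 * #K
  · exact ⟨K, hK, fun x hx => (hle x hx).trans_lt h, rfl⟩
  · refine ⟨(range (M + 1) \ K).image (M - ·), ?_, ?_, hookLengths_image_range_sdiff hle⟩
    · simp only [mem_image, mem_sdiff, mem_range, not_exists, not_and]
      rintro x ⟨h1, h2⟩ h3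
      have : x = M := by omega
      rw [this] at h2
      exact h2 hmem
    · rw [card_image_of_injOn, card_sdiff_of_subset hsub, card_range]
      · intro x hx
        simp only [mem_image] at hx
        obtain ⟨y, -, rfl⟩ := hx
        have := card_le_card hsub
        rw [card_range] at this
        omega
      · intro x hx y hy hxy
        simp at hx hy hxy
        omega

end Normalization

section PrimePowerBound

variable {p : ℕ}

theorem prod_Icc_one_eq_factorial (n : ℕ) : ∏ x ∈ Icc 1 n, x = n.factorial := by
  induction n with
  | zero => rfl
  | succ n ih => rw [Finset.prod_Icc_succ_top (by omega), ih, Nat.factorial_succ, mul_comm]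

theorem ordProj_factorial_le (hp : p.Prime) {t : ℕ} (ht : 1 ≤ t) :
    p ^ t.factorial.factorization p ≤ 2 ^ (t - 1) := by
  have := Fact.mk hp
  have h1 := sub_one_mul_padicValNat_factorial (p := p) t
  rw [← Nat.factorization_def _ hp] at h1
  have h2 : 1 ≤ (p.digits t).sum := by
    have h3 : p.digits t ≠ [] := Nat.digits_ne_nil_iff_ne_zero.2 (by omega)
    exact (Nat.one_le_iff_ne_zero.2 (Nat.getLast_digit_ne_zero p (by omega))).trans
      (List.le_sum_of_mem (List.getLast_mem h3))
  have h3 : p ≤ 2 ^ (p - 1) := by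
    have := Nat.lt_two_pow_self (n := p - 1)
    have := hp.two_le
    omega
  calc p ^ t.factorial.factorization p ≤ (2 ^ (p - 1)) ^ t.factorial.factorization p :=
        Nat.pow_le_pow_left h3 _
    _ = 2 ^ ((p - 1) * t.factorial.factorization p) := (pow_mul _ _ _).symm
    _ ≤ 2 ^ (t - 1) := Nat.pow_le_pow_right (by norm_num) (by omega)

theorem ordProj_factorial_add_le (hp : p.Prime) {k t : ℕ} (ht : 1 ≤ t) :
    p ^ (k + t).factorial.factorization p ≤
      (k + t) * 2 ^ (t - 1) * p ^ k.factorial.factorization p := by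
  have h := Nat.add_choose_mul_factorial_mul_factorial k t
  have h0 : (k + t).choose t ≠ 0 := (Nat.choose_pos (Nat.le_add_left t k)).ne'
  have hk := k.factorial_ne_zero
  rw [← h, Nat.ordProj_mul p (mul_ne_zero h0 hk) t.factorial_ne_zero, Nat.ordProj_mul p h0 hk]
  have h1 : p ^ ((k + t).choose t).factorization p ≤ k + t :=
    Nat.pow_factorization_choose_le (by omega)
  have h2 := ordProj_factorial_le hp ht
  calc _ ≤ (k + t) * p ^ k.factorial.factorization p * 2 ^ (t - 1) := by gcongr
    _ = _ := by ring

theorem prod_erase_ordProj_dvd {X : Finset ℕ} {m n y : ℕ} (hX : X ⊆ Icc m n)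
    (hy : y ∈ X) (hmax : ∀ x ∈ X, x.factorization p ≤ y.factorization p) :
    ∏ x ∈ X.erase y, p ^ x.factorization p ∣ (n - m).factorial := by
  have hy' := mem_Icc.1 (hX hy)
  have hsplit : X.erase y = (X.filter (· < y)) ∪ (X.filter (y < ·)) := by
    ext x
    rw [mem_erase, mem_union, mem_filter, mem_filter, ← and_or_left, ← lt_or_lt_iff_ne, and_comm]
  have hd : Disjoint (X.filter (· < y)) (X.filter (y < ·)) :=
    disjoint_filter.2 fun x _ h => h.not_gt
  have hdvd : ∀ x ∈ X, p ^ x.factorization p ∣ x ∧ p ^ x.factorization p ∣ y := fun x hx =>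
    ⟨Nat.ordProj_dvd x p, (pow_dvd_pow p (hmax x hx)).trans (Nat.ordProj_dvd y p)⟩
  rw [hsplit, prod_union hd, show n - m = (y - m) + (n - y) by omega]
  refine (mul_dvd_mul ?_ ?_).trans (Nat.factorial_mul_factorial_dvd_factorial_add _ _)
  · rw [← prod_Icc_one_eq_factorial]
    have h1 : ∏ x ∈ X.filter (· < y), (y - x) ∣ ∏ x ∈ Icc 1 (y - m), x := by
      rw [← Finset.prod_image (s := X.filter (· < y)) (g := (y - ·)) (f := fun z : ℕ => z)]
      · refine Finset.prod_dvd_prod_of_subset _ _ _ fun z hz => ?_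
        simp only [mem_image, mem_filter] at hz
        obtain ⟨x, ⟨hx, hxy⟩, rfl⟩ := hz
        have := mem_Icc.1 (hX hx)
        rw [mem_Icc]
        omega
      · intro a ha b hb hab
        simp at ha hb hab
        omega
    refine (Finset.prod_dvd_prod_of_dvd _ _ fun x hx => ?_).trans h1
    obtain ⟨h2, h3⟩ := hdvd x (mem_filter.1 hx).1
    exact Nat.dvd_sub h3 h2
  · rw [← prod_Icc_one_eq_factorial]
    have h1 : ∏ x ∈ X.filter (y < ·), (x - y) ∣ ∏ x ∈ Icc 1 (n - y), x := by
      rw [← Finset.prod_image (s := X.filter (y < ·)) (g := (· - y)) (f := fun z : ℕ => z)]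
      · refine Finset.prod_dvd_prod_of_subset _ _ _ fun z hz => ?_
        simp only [mem_image, mem_filter] at hz
        obtain ⟨x, ⟨hx, hxy⟩, rfl⟩ := hz
        have := mem_Icc.1 (hX hx)
        rw [mem_Icc]
        omega
      · intro a ha b hb hab
        simp at ha hb hab
        omega
    refine (Finset.prod_dvd_prod_of_dvd _ _ fun x hx => ?_).trans h1
    obtain ⟨h2, h3⟩ := hdvd x (mem_filter.1 hx).1
    exact Nat.dvd_sub h2 h3

theorem prod_le_of_dvd_prime_pow_mul_factorial (hp : p.Prime) {X : Finset ℕ} {m n k t d : ℕ}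
    (hX : X ⊆ Icc m n) (hm : 1 ≤ m) (hne : X.Nonempty) (ht : 1 ≤ t) (hmt : n - m ≤ k + t)
    (hdvd : ∏ x ∈ X, x ∣ p ^ d * k.factorial) :
    ∏ x ∈ X, x ≤ n * (k + t) * 2 ^ (t - 1) * k.factorial := by
  obtain ⟨y, hy, hmax⟩ := X.exists_max_image (fun x => x.factorization p) hne
  have hX0 : ∀ x ∈ X, x ≠ 0 := fun x hx => by
    have := mem_Icc.1 (hX hx)
    omega
  have hP0 : ∏ x ∈ X, x ≠ 0 := prod_ne_zero_iff.2 hX0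
  set P := ∏ x ∈ X, x with hP
  have h1 : p ^ P.factorization p =
      p ^ y.factorization p * ∏ x ∈ X.erase y, p ^ x.factorization p := by
    rw [mul_prod_erase X (fun x => p ^ x.factorization p) hy, hP, Nat.factorization_prod hX0,
      Finsupp.finsetSum_apply, Finset.prod_pow_eq_pow_sum]
  have h2 : p ^ y.factorization p ≤ n :=
    (Nat.ordProj_le p (hX0 y hy)).trans (mem_Icc.1 (hX hy)).2
  have h3 : ∏ x ∈ X.erase y, p ^ x.factorization p ≤ p ^ (k + t).factorial.factorization p := by
    have h4 := (prod_erase_ordProj_dvd hX hy hmax).trans (Nat.factorial_dvd_factorial hmt)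
    rw [Finset.prod_pow_eq_pow_sum] at h4 ⊢
    exact Nat.pow_le_pow_right hp.pos
      ((hp.pow_dvd_iff_le_factorization (Nat.factorial_ne_zero _)).1 h4)
  have h5 : p ^ P.factorization p ≤ n * ((k + t) * 2 ^ (t - 1) * p ^ k.factorial.factorization p) := by
    rw [h1]
    exact Nat.mul_le_mul h2 (h3.trans (ordProj_factorial_add_le hp ht))
  have hcop : (p ^ k.factorial.factorization p).Coprime (P / p ^ P.factorization p) :=
    (Nat.coprime_ordCompl hp hP0).pow_left _
  have h6 : P / p ^ P.factorization p ∣ k.factorial :=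
    ((Nat.coprime_ordCompl hp hP0).pow_left d).symm.dvd_of_dvd_mul_left
      ((Nat.ordCompl_dvd P p).trans hdvd)
  have h7 : p ^ k.factorial.factorization p * (P / p ^ P.factorization p) ≤ k.factorial :=
    Nat.le_of_dvd k.factorial_pos
      (hcop.mul_dvd_of_dvd_of_dvd (Nat.ordProj_dvd _ _) h6)
  calc P = p ^ P.factorization p * (P / p ^ P.factorization p) :=
        (Nat.ordProj_mul_ordCompl_eq_self P p).symm
    _ ≤ n * ((k + t) * 2 ^ (t - 1) * p ^ k.factorial.factorization p) *
        (P / p ^ P.factorization p) := Nat.mul_le_mul_right _ h5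
    _ = n * (k + t) * 2 ^ (t - 1) *
        (p ^ k.factorial.factorization p * (P / p ^ P.factorization p)) := by ring
    _ ≤ _ := Nat.mul_le_mul_left _ h7

end PrimePowerBound

section FirstColumn

variable {H : Finset ℕ}

theorem betaSize_add_sum_range (H : Finset ℕ) :
    betaSize H + ∑ i ∈ range #H, i = ∑ x ∈ H, x := by
  have h := betaSize_image_add (H.orderEmbOfFin rfl).strictMono
  have hH : univ.image (H.orderEmbOfFin rfl) = H := by simp
  rw [hH, Fin.sum_univ_eq_sum_range (fun i => i)] at h
  rw [h]
  conv_rhs => rw [← hH]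
  exact (Finset.sum_image (f := fun x : ℕ => x) (H.orderEmbOfFin rfl).injective.injOn).symm

theorem range_sdiff_eq_insert (hH : 0 ∉ H) {x : ℕ} (hx : x ∈ H) :
    range x \ H = insert 0 ((range (x - 1) \ H.image Nat.pred).image Nat.succ) := by
  have hx0 : x ≠ 0 := fun h => hH (h ▸ hx)
  ext y
  simp only [mem_sdiff, mem_range, mem_insert, mem_image, not_exists, not_and]
  constructor
  · rintro ⟨h1, h2⟩
    refine y.eq_zero_or_pos.imp_right fun h => ⟨y - 1, ⟨by omega, fun z hz hzy => h2 ?_⟩, by omega⟩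
    have hz0 : z ≠ 0 := fun h => hH (h ▸ hz)
    rw [Nat.pred_eq_sub_one] at hzy
    rwa [show y = z by omega]
  · rintro (rfl | ⟨z, ⟨h1, h2⟩, rfl⟩)
    · exact ⟨by omega, hH⟩
    · exact ⟨by omega, fun h => h2 _ h rfl⟩

theorem pred_injOn (hH : 0 ∉ H) : Set.InjOn Nat.pred H := by
  intro x hx y hy hxy
  have hx0 : x ≠ 0 := fun h => hH (h ▸ hx)
  have hy0 : y ≠ 0 := fun h => hH (h ▸ hy)
  simp only [Nat.pred_eq_sub_one] at hxy
  omega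

theorem betaSize_eq_betaSize_image_pred_add (hH : 0 ∉ H) :
    betaSize H = betaSize (H.image Nat.pred) + #H := by
  rw [betaSize, betaSize, Finset.sum_image (pred_injOn hH), card_eq_sum_ones,
    ← Finset.sum_add_distrib]
  refine Finset.sum_congr rfl fun x hx => ?_
  rw [range_sdiff_eq_insert hH hx, card_insert_of_notMem (by simp),
    card_image_of_injective _ Nat.succ_injective]
  rfl

theorem hookProd_eq_hookProd_image_pred_mul (hH : 0 ∉ H) :
    hookProd H = hookProd (H.image Nat.pred) * ∏ x ∈ H, x := by
  rw [hookProd, hookProd, Finset.prod_image (pred_injOn hH), ← Finset.prod_mul_distrib]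
  refine Finset.prod_congr rfl fun x hx => ?_
  rw [range_sdiff_eq_insert hH hx, Finset.prod_insert (by simp),
    Finset.prod_image Nat.succ_injective.injOn, Nat.sub_zero, mul_comm]
  congr 1
  refine Finset.prod_congr rfl fun y _ => ?_
  rw [Nat.pred_eq_sub_one]
  omega

theorem le_betaSize (hH : 0 ∉ H) {x : ℕ} (hx : x ∈ H) : x ≤ betaSize H := by
  have h1 : ∀ y ∈ H, 1 ≤ #(range y \ H) := fun y hy => card_pos.2
    ⟨0, mem_sdiff.2 ⟨mem_range.2 (Nat.pos_of_ne_zero fun h => hH (h ▸ hy)), hH⟩⟩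
  have h2 := card_sdiff_add_card_inter (range x) H
  have h3 : #(range x ∩ H) ≤ ∑ y ∈ H.erase x, #(range y \ H) := by
    rw [card_eq_sum_ones]
    refine (Finset.sum_le_sum_of_subset fun y hy => ?_).trans
      (Finset.sum_le_sum fun y hy => h1 y (mem_of_mem_erase hy))
    simp only [mem_inter, mem_range] at hy
    exact mem_erase.2 ⟨hy.1.ne, hy.2⟩
  have h4 := Finset.add_sum_erase H (fun y => #(range y \ H)) hx
  rw [card_range] at h2
  rw [betaSize]
  omega

theorem two_mul_card_lt_betaSize_add (hH : 0 ∉ H) {m : ℕ} (hm : 1 ≤ m) (hmH : m ∉ H) :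
    2 * #H < betaSize H + m := by
  have h1 : ∀ y ∈ H, 1 + (if m < y then 1 else 0) ≤ #(range y \ H) := by
    intro y hy
    have hy0 : 0 < y := Nat.pos_of_ne_zero fun h => hH (h ▸ hy)
    split_ifs with h
    · rw [show 1 + 1 = #({0, m} : Finset ℕ) from (card_pair (by omega)).symm]
      refine card_le_card fun z hz => ?_
      rw [mem_insert, mem_singleton] at hz
      rw [mem_sdiff, mem_range]
      rcases hz with rfl | rfl
      · exact ⟨hy0, hH⟩
      · exact ⟨h, hmH⟩
    · exact card_pos.2 ⟨0, mem_sdiff.2 ⟨mem_range.2 hy0, hH⟩⟩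
  have h2 := Finset.sum_le_sum h1
  rw [Finset.sum_add_distrib, ← card_eq_sum_ones, ← card_filter, ← betaSize] at h2
  have h3 := card_filter_add_card_filter_not (s := H) (m < ·)
  have h4 : #(H.filter (¬ m < ·)) ≤ m - 1 := by
    refine (card_le_card (t := Icc 1 (m - 1)) fun y hy => ?_).trans (by simp)
    simp only [mem_filter] at hy
    have hy0 : y ≠ 0 := fun h => hH (h ▸ hy.1)
    have hym : y ≠ m := fun h => hmH (h ▸ hy.1)
    rw [mem_Icc]
    omega
  omega

theorem subset_Icc_betaSize (hH : 0 ∉ H) : H ⊆ Icc 1 (betaSize H) := fun x hx => by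
  have h0 : x ≠ 0 := fun h => hH (h ▸ hx)
  have := le_betaSize hH hx
  rw [mem_Icc]
  omega

theorem mul_hookProd_image_pred_eq (hH : 0 ∉ H) {D : ℕ}
    (hD : D * hookProd H = (betaSize H).factorial) :
    D * hookProd (H.image Nat.pred) = ∏ x ∈ Icc 1 (betaSize H) \ H, x := by
  have h1 : ∏ x ∈ H, x ≠ 0 := prod_ne_zero_iff.2 fun x hx h => hH (h ▸ hx)
  refine mul_right_cancel₀ h1 ?_
  rw [mul_assoc, ← hookProd_eq_hookProd_image_pred_mul hH, hD,
    Finset.prod_sdiff (subset_Icc_betaSize hH), prod_Icc_one_eq_factorial]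

theorem factorial_le_of_prime_pow_mul_hookProd {p d : ℕ} (hp : p.Prime) (hH : 0 ∉ H) {k : ℕ}
    (hk : betaSize H = k + #H) (hk2 : 2 ≤ k) (hr2 : 2 ≤ #H)
    (hD : p ^ d * hookProd H = (betaSize H).factorial) :
    (k + #H).factorial ≤ (k + #H) * (k + (min k #H - 1)) * 2 ^ (min k #H - 2) * k.factorial *
      ∏ x ∈ H, x := by
  have h1 := mul_hookProd_image_pred_eq hH hD
  have h2 := betaSize_eq_betaSize_image_pred_add hH
  have h3 : betaSize (H.image Nat.pred) = k := by omega
  have hcard : #(Icc 1 (betaSize H) \ H) = k := by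
    rw [card_sdiff_of_subset (subset_Icc_betaSize hH), Nat.card_Icc]
    omega
  have hne : (Icc 1 (betaSize H) \ H).Nonempty := card_pos.1 (by omega)
  set X := Icc 1 (betaSize H) \ H with hX
  have hm := mem_sdiff.1 (X.min'_mem hne)
  rw [mem_Icc] at hm
  have h4 := two_mul_card_lt_betaSize_add hH hm.1.1 hm.2
  have h5 : X ⊆ Icc (X.min' hne) (betaSize H) := fun x hx =>
    mem_Icc.2 ⟨X.min'_le x hx, (mem_Icc.1 (mem_sdiff.1 hx).1).2⟩
  have h6 := prod_le_of_dvd_prime_pow_mul_factorial hp h5 hm.1.1 hne (k := k)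
    (t := min k #H - 1) (by omega) (by omega) (d := d) (by
      rw [← h1]
      refine mul_dvd_mul_left _ ?_
      have := hookProd_dvd_factorial (H.image Nat.pred)
      rwa [h3] at this)
  have h7 : (betaSize H).factorial = (∏ x ∈ X, x) * ∏ x ∈ H, x := by
    rw [hX, Finset.prod_sdiff (subset_Icc_betaSize hH), prod_Icc_one_eq_factorial]
  rw [hk] at h6 h7
  rw [h7, show min k #H - 2 = min k #H - 1 - 1 by omega]
  exact Nat.mul_le_mul_right _ h6

theorem eq_one_of_betaSize_eq_card (hH : 0 ∉ H) {D : ℕ} (hk : betaSize H = #H)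
    (hD : D * hookProd H = (betaSize H).factorial) : D = 1 := by
  have h1 := mul_hookProd_image_pred_eq hH hD
  have hcard : #(Icc 1 (betaSize H) \ H) = 0 := by
    rw [card_sdiff_of_subset (subset_Icc_betaSize hH), Nat.card_Icc]
    omega
  rw [card_eq_zero.1 hcard, Finset.prod_empty] at h1
  exact Nat.eq_one_of_mul_eq_one_right h1

theorem betaSize_eq_add_one_of_betaSize_eq_card_add_one (hH : 0 ∉ H) {D : ℕ}
    (hk : betaSize H = #H + 1) (hD : D * hookProd H = (betaSize H).factorial) :
    betaSize H = D + 1 := by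
  have h1 := mul_hookProd_image_pred_eq hH hD
  have hcard : #(Icc 1 (betaSize H) \ H) = 1 := by
    rw [card_sdiff_of_subset (subset_Icc_betaSize hH), Nat.card_Icc]
    omega
  obtain ⟨y, hy⟩ := card_eq_one.1 hcard
  have h2 := betaSize_eq_betaSize_image_pred_add hH
  have h3 := hookProd_dvd_factorial (H.image Nat.pred)
  rw [show betaSize (H.image Nat.pred) = 1 by omega, Nat.factorial_one, Nat.dvd_one] at h3
  rw [hy, h3, Finset.prod_singleton, mul_one] at h1
  have h4 := Finset.sum_sdiff (f := fun x : ℕ => x) (subset_Icc_betaSize hH)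
  rw [hy, Finset.sum_singleton, ← betaSize_add_sum_range] at h4
  have h5 : ∑ x ∈ Icc 1 (betaSize H), x = ∑ i ∈ range #H, i + #H + (#H + 1) := by
    rw [← Finset.sum_range_succ, ← Finset.sum_range_succ, hk, Finset.range_eq_Ico,
      Finset.sum_eq_sum_Ico_succ_bot (by omega), zero_add]
    rfl
  omega

end FirstColumn

section FiniteSearchSound

theorem hookProd_insert_mul_prod_sub {x : ℕ} {H : Finset ℕ} (hx : ∀ z ∈ H, x < z) :
    hookProd (insert x H) * ∏ z ∈ H, (z - x) = x.factorial * hookProd H := by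
  have hxH : x ∉ H := fun h => (hx x h).false
  rw [hookProd, Finset.prod_insert hxH, mul_assoc, hookProd, ← Finset.prod_mul_distrib]
  congr 1
  · rw [← Nat.descFactorial_self, Nat.descFactorial_eq_prod_range, sdiff_eq_self_of_disjoint]
    rw [disjoint_left]
    intro y hy hy'
    rw [mem_range] at hy
    rcases mem_insert.1 hy' with h | h
    · omega
    · have := hx y h
      omega
  · refine Finset.prod_congr rfl fun z hz => ?_
    have h : range z \ H = insert x (range z \ insert x H) := by
      ext y
      have := hx z hz
      simp only [mem_sdiff, mem_range, mem_insert, not_or]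
      by_cases hy : y = x
      · subst hy
        simp [hxH, this]
      · simp [hy]
    rw [h, Finset.prod_insert (by simp), mul_comm]

theorem listDiffProd_eq_prod {b : ℕ} : ∀ {l : List ℕ}, l.Pairwise (· < ·) →
    listDiffProd b l = ∏ z ∈ l.toFinset, (z - b)
  | [], _ => by simp [listDiffProd]
  | x :: l, h => by
    rw [List.pairwise_cons] at h
    rw [List.toFinset_cons, Finset.prod_insert (fun hx => (h.1 x (by simpa using hx)).false),
      ← listDiffProd_eq_prod h.2, listDiffProd]

theorem hookProd_mul_listVandermonde : ∀ {l : List ℕ}, l.Pairwise (· < ·) →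
    hookProd l.toFinset * listVandermonde l = listFactorialProd l
  | [], _ => by simp [listVandermonde, listFactorialProd, hookProd]
  | x :: l, h => by
    rw [List.pairwise_cons] at h
    rw [List.toFinset_cons, listVandermonde, listFactorialProd, ← mul_assoc,
      listDiffProd_eq_prod h.2,
      hookProd_insert_mul_prod_sub (fun z hz => h.1 z (by simpa using hz)), mul_assoc,
      hookProd_mul_listVandermonde h.2]

theorem listFactorialProd_pos : ∀ l : List ℕ, 0 < listFactorialProd l
  | [] => Nat.one_pos
  | x :: l => Nat.mul_pos x.factorial_pos (listFactorialProd_pos l)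

theorem sum_bounds_of_lt (b : ℕ) : ∀ H : Finset ℕ, (∀ x ∈ H, 0 < x ∧ x < b) →
    #H * (#H + 1) ≤ 2 * ∑ x ∈ H, x ∧ 2 * ∑ x ∈ H, x + #H * (#H + 1) ≤ 2 * #H * b := by
  induction b with
  | zero =>
    intro H hH
    obtain rfl : H = ∅ := eq_empty_of_forall_notMem fun x hx => by have := hH x hx; omega
    simp
  | succ b ih =>
    intro H hH
    by_cases hb : b ∈ H
    · obtain ⟨h1, h2⟩ := ih (H.erase b) fun x hx => by
        have := hH x (mem_of_mem_erase hx)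
        have := ne_of_mem_erase hx
        omega
      have h3 := card_erase_add_one hb
      have h4 := Finset.add_sum_erase H (fun x => x) hb
      have h5 := (hH b hb).1
      rw [← h3, ← h4]
      generalize #(H.erase b) = i at *
      generalize ∑ x ∈ H.erase b, x = s at *
      have h6 : i + 1 ≤ b := by
        rcases i.eq_zero_or_pos with h | h
        · omega
        · have : i * (i + 1) ≤ i * b := by nlinarith
          exact Nat.le_of_mul_le_mul_left this h
      constructor <;> nlinarith
    · obtain ⟨h1, h2⟩ := ih H fun x hx => by
        have := hH x hx
        have : x ≠ b := fun h => hb (h ▸ hx)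
        omega
      exact ⟨h1, by nlinarith⟩

theorem exists_of_searchTest {n F : ℕ} (b : ℕ) : ∀ (i s : ℕ) (l : List ℕ),
    searchTest n F b i s l = true → l.Pairwise (· < ·) → (∀ x ∈ l, b ≤ x) →
    ∀ H : Finset ℕ, (∀ x ∈ H, 0 < x ∧ x < b) → #H = i → ∑ x ∈ H, x = s →
    ∃ l' : List ℕ, l'.Pairwise (· < ·) ∧ l'.toFinset = H ∪ l.toFinset ∧
      degreeTest n (F * listVandermonde l' / listFactorialProd l') = true := by
  induction b with
  | zero =>
    intro i s l h hl _ H hH hi _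
    obtain rfl : H = ∅ := eq_empty_of_forall_notMem fun x hx => by have := hH x hx; omega
    obtain rfl : 0 = i := by simpa using hi
    exact ⟨l, hl, by simp, by rwa [searchTest] at h⟩
  | succ b ih =>
    intro i s l h hl hlb H hH hi hs
    obtain _ | i := i
    · rw [card_eq_zero.1 hi]
      exact ⟨l, hl, by simp, by rwa [searchTest] at h⟩
    obtain ⟨h1, h2⟩ := sum_bounds_of_lt (b + 1) H hH
    rw [hi, hs] at h1 h2
    obtain _ | s := s
    · nlinarith
    rw [searchTest] at h
    simp only [Bool.or_eq_true, Bool.and_eq_true, Nat.blt_eq] at h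
    obtain (h | h) | ⟨h3, h4⟩ := h
    · nlinarith
    · nlinarith
    by_cases hb : b ∈ H
    · have h5 := card_erase_add_one hb
      have h6 := Finset.add_sum_erase H (fun x => x) hb
      obtain h4 | h4 := h4
      · omega
      obtain ⟨l', h7, h8, h9⟩ := ih i (s + 1 - b) (b :: l) h4
        (List.pairwise_cons.2 ⟨fun x hx => hlb x hx, hl⟩)
        (fun x hx => by
          rcases List.mem_cons.1 hx with rfl | hx
          · exact le_rfl
          · exact (Nat.le_succ b).trans (hlb x hx))
        (H.erase b) (fun x hx => by
          have := hH x (mem_of_mem_erase hx)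
          have := ne_of_mem_erase hx
          omega) (by omega) (by omega)
      refine ⟨l', h7, ?_, h9⟩
      rw [h8, List.toFinset_cons, union_insert, ← insert_union, insert_erase hb]
    · exact ih (i + 1) (s + 1) l h3 hl (fun x hx => (Nat.le_succ b).trans (hlb x hx)) H
        (fun x hx => by
          have := hH x hx
          have : x ≠ b := fun h => hb (h ▸ hx)
          omega) hi hs

theorem of_degreeTest {n p d : ℕ} (hp : p.Prime) (hd : 1 ≤ d)
    (h : degreeTest n (p ^ d) = true) :
    n = p ^ d + 1 ∨
    (n = 4 ∧ p ^ d = 2) ∨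
    (n = 5 ∧ p ^ d = 5) ∨
    (n = 6 ∧ (p ^ d = 9 ∨ p ^ d = 16)) ∨
    (n = 8 ∧ p ^ d = 64) ∨
    (n = 9 ∧ p ^ d = 27) := by
  have h1 : 2 ≤ p ^ d := hp.two_le.trans (Nat.le_self_pow (by omega) p)
  obtain ⟨D, hD⟩ : ∃ D, p ^ d = D + 1 := ⟨p ^ d - 1, by omega⟩
  have h2 : ¬ 2 ≤ [2, 3, 5, 7, 11, 13].countP fun q => (D + 1) % q == 0 := by
    have h3 : [2, 3, 5, 7, 11, 13].countP (fun q => (D + 1) % q == 0) ≤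
        [2, 3, 5, 7, 11, 13].countP (· == p) := by
      refine List.countP_mono_left fun q hq hq' => ?_
      have hqp : q.Prime := by
        fin_cases hq <;> norm_num
      rw [beq_iff_eq, ← hD] at hq'
      exact beq_iff_eq.2
        ((Nat.prime_dvd_prime_iff_eq hqp hp).1 (hqp.dvd_of_dvd_pow (Nat.dvd_of_mod_eq_zero hq')))
    have h4 : [2, 3, 5, 7, 11, 13].count p ≤ 1 := List.nodup_iff_count_le_one.1 (by decide) p
    exact fun h => absurd (h.trans (h3.trans h4)) (by norm_num)
  rw [hD] at h h1 ⊢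
  simp only [degreeTest, Bool.or_eq_true, Nat.ble_eq, h2, beq_iff_eq, Bool.and_eq_true, false_or] at h
  omega

theorem of_pairTest {p d k : ℕ} (hp : p.Prime) (hd : 1 ≤ d) {H : Finset ℕ} (hH : 0 ∉ H)
    (hH2 : ∀ x ∈ H, x < 2 * #H) (hk : betaSize H = k + #H) (hk2 : 2 ≤ k) (hr2 : 2 ≤ #H)
    (hD : p ^ d * hookProd H = (betaSize H).factorial)
    (hle : #H ^ #H * ∏ x ∈ H, x ≤ shiftedProd #H k) (h : pairTest #H k = true) :
    betaSize H = p ^ d + 1 ∨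
    (betaSize H = 4 ∧ p ^ d = 2) ∨
    (betaSize H = 5 ∧ p ^ d = 5) ∨
    (betaSize H = 6 ∧ (p ^ d = 9 ∨ p ^ d = 16)) ∨
    (betaSize H = 8 ∧ p ^ d = 64) ∨
    (betaSize H = 9 ∧ p ^ d = 27) := by
  rw [pairTest, Bool.or_eq_true, Nat.blt_eq] at h
  obtain h | h := h
  · exfalso
    have h1 := factorial_le_of_prime_pow_mul_hookProd hp hH hk hk2 hr2 hD
    have h2 := Nat.factorial_mul_descFactorial (n := #H + k) (k := #H) (by omega)
    rw [Nat.add_sub_cancel_left] at h2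
    rw [add_comm k #H, ← h2] at h1
    refine h.not_ge ?_
    have hr : 0 < #H ^ #H := by positivity
    refine Nat.le_of_mul_le_mul_left ?_ k.factorial_pos
    calc k.factorial * ((#H + k).descFactorial #H * #H ^ #H)
        = k.factorial * (#H + k).descFactorial #H * #H ^ #H := by ring
      _ ≤ (#H + k) * (k + (min k #H - 1)) * 2 ^ (min k #H - 2) * k.factorial *
          (∏ x ∈ H, x) * #H ^ #H := Nat.mul_le_mul_right _ h1
      _ = k.factorial * ((#H + k) * (k + (min k #H - 1)) * 2 ^ (min k #H - 2)) *
          (#H ^ #H * ∏ x ∈ H, x) := by ring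
      _ ≤ k.factorial * ((#H + k) * (k + (min k #H - 1)) * 2 ^ (min k #H - 2)) *
          shiftedProd #H k := Nat.mul_le_mul_left _ hle
      _ = _ := by ring
  · have hs : ∑ x ∈ H, x = k + #H * (#H + 1) / 2 := by
      have h1 := betaSize_add_sum_range H
      have h2 := Finset.sum_range_id (#H + 1)
      rw [Finset.sum_range_succ, Nat.add_sub_cancel, mul_comm] at h2
      omega
    obtain ⟨l, hl, hlH, hl'⟩ := exists_of_searchTest _ _ _ _ h List.Pairwise.nil (by simp) H
      (fun x hx => ⟨Nat.pos_of_ne_zero fun h => hH (h ▸ hx), hH2 x hx⟩) rfl hs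
    rw [List.toFinset_nil, union_empty] at hlH
    have h3 := hookProd_mul_listVandermonde hl
    rw [hlH] at h3
    rw [add_comm #H k, ← hk] at hl'
    have h4 : (betaSize H).factorial * listVandermonde l / listFactorialProd l = p ^ d := by
      rw [← hD, mul_assoc, h3, Nat.mul_div_cancel _ (listFactorialProd_pos l)]
    rw [h4] at hl'
    exact of_degreeTest hp hd hl'

end FiniteSearchSound

section ShiftedProduct

theorem StrictMono.monotone_sub_val {r : ℕ} {β : Fin r → ℕ} (hβ : StrictMono β) :
    Monotone fun i => (β i : ℝ) - (i : ℕ) := by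
  intro i j hij
  have h1 : (Ioc i j).image β ⊆ Ioc (β i) (β j) := by
    intro x hx
    obtain ⟨y, hy, rfl⟩ := mem_image.1 hx
    rw [mem_Ioc] at hy ⊢
    exact ⟨hβ hy.1, hβ.monotone hy.2⟩
  have h2 := card_le_card h1
  rw [card_image_of_injective _ hβ.injective, Fin.card_Ioc, Nat.card_Ioc] at h2
  have h3 := hβ.monotone hij
  have h4 : (i : ℕ) ≤ j := hij
  have h5 : (j : ℕ) + β i ≤ β j + i := by omega
  have h6 : ((j : ℕ) : ℝ) + β i ≤ β j + (i : ℕ) := by exact_mod_cast h5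
  simp only
  linarith

theorem card_pow_mul_prod_le_shiftedProd {H : Finset ℕ} {k : ℕ} (hk : betaSize H = k + #H) :
    #H ^ #H * ∏ x ∈ H, x ≤ shiftedProd #H k := by
  set r := #H with hr
  obtain h0 | h0 := r.eq_zero_or_pos
  · rw [card_eq_zero.1 (hr.symm.trans h0), h0]
    simp [shiftedProd]
  set β := H.orderEmbOfFin rfl with hβdef
  have hβ : StrictMono β := β.strictMono
  have hH : univ.image β = H := by simp [hβdef]
  have hsum : ∑ i : Fin r, ((r : ℝ) * (β i - (i : ℕ) - 1) - k) = 0 := by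
    have h1 := betaSize_image_add hβ
    rw [hH, hk] at h1
    have h2 : (k : ℝ) + r + ∑ i : Fin r, ((i : ℕ) : ℝ) = ∑ i, (β i : ℝ) := by exact_mod_cast h1
    rw [Finset.sum_sub_distrib, ← Finset.mul_sum, Finset.sum_sub_distrib,
      Finset.sum_sub_distrib, ← h2]
    simp
  have hpos : ∀ i : Fin r, (0 : ℝ) < r * ((i : ℕ) + 1) + k := fun i => by positivity
  have hanti : Antivary (fun i : Fin r => (r : ℝ) * (β i - (i : ℕ) - 1) - k)
      (fun i : Fin r => ((r : ℝ) * ((i : ℕ) + 1) + k)⁻¹) := by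
    refine Monotone.antivary (fun i j hij => ?_) fun i j hij => ?_
    · have := hβ.monotone_sub_val hij
      simp only at this ⊢
      gcongr
    · have : (i : ℕ) ≤ j := hij
      gcongr
  have hcheb := hanti.card_mul_sum_le_sum_mul_sum
  rw [hsum, zero_mul, Fintype.card_fin] at hcheb
  have h1 : ∑ i : Fin r, ((r : ℝ) * (β i - (i : ℕ) - 1) - k) * ((r : ℝ) * ((i : ℕ) + 1) + k)⁻¹ ≤ 0 :=
    nonpos_of_mul_nonpos_right hcheb (by exact_mod_cast h0)
  have h2 : ∀ i : Fin r, (r : ℝ) * β i ≤ (r * ((i : ℕ) + 1) + k) *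
      Real.exp (((r : ℝ) * (β i - (i : ℕ) - 1) - k) * ((r : ℝ) * ((i : ℕ) + 1) + k)⁻¹) := by
    intro i
    have h3 := Real.add_one_le_exp
      (((r : ℝ) * (β i - (i : ℕ) - 1) - k) * ((r : ℝ) * ((i : ℕ) + 1) + k)⁻¹)
    have h4 := mul_le_mul_of_nonneg_left h3 (hpos i).le
    refine le_trans (le_of_eq ?_) h4
    field_simp [(hpos i).ne']
    ring
  have h3 := Finset.prod_le_prod (s := univ) (fun i _ => by positivity) fun i _ => h2 i
  rw [Finset.prod_mul_distrib, Finset.prod_mul_distrib, ← Real.exp_sum] at h3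
  have h4 : (0 : ℝ) ≤ ∏ i : Fin r, ((r : ℝ) * ((i : ℕ) + 1) + k) := prod_nonneg fun i _ => (hpos i).le
  have h5 := h3.trans (mul_le_of_le_one_right h4 (Real.exp_le_one_iff.2 h1))
  rw [Fin.prod_univ_eq_prod_range (fun i => (r : ℝ) * ((i : ℝ) + 1) + k),
    Finset.prod_const, card_univ, Fintype.card_fin] at h5
  have h6 : ∏ i, β i = ∏ x ∈ H, x := by
    conv_rhs => rw [← hH]
    exact (Finset.prod_image (f := fun x : ℕ => x) hβ.injective.injOn).symm
  rw [← h6, shiftedProd]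
  exact_mod_cast h5

theorem le_card_mul_card_sub_one {H : Finset ℕ} {k : ℕ} (hH : 0 ∉ H)
    (hH2 : ∀ x ∈ H, x < 2 * #H) (hk : betaSize H = k + #H) : k ≤ #H * (#H - 1) := by
  have h1 := (sum_bounds_of_lt (2 * #H) H fun x hx =>
    ⟨Nat.pos_of_ne_zero fun h => hH (h ▸ hx), hH2 x hx⟩).2
  have h2 := betaSize_add_sum_range H
  have h3 := Finset.sum_range_id_mul_two #H
  obtain h | h := Nat.eq_zero_or_pos #H
  · rw [card_eq_zero.1 h] at hk h2
    simp_all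
  · obtain ⟨r, hr⟩ : ∃ r, #H = r + 1 := ⟨#H - 1, by omega⟩
    rw [hr] at h1 h2 h3 hk ⊢
    rw [Nat.add_sub_cancel] at h3 ⊢
    nlinarith

end ShiftedProduct

section LargeRows

/-- The product of the numbers `i + 1 + k / r` for `i < r`. -/
noncomputable def meanProd (r k : ℕ) : ℝ := ∏ i ∈ range r, ((i : ℝ) + 1 + k / r)

theorem meanProd_pos (r k : ℕ) : 0 < meanProd r k := prod_pos fun i _ => by positivity

theorem shiftedProd_eq_pow_mul_meanProd {r : ℕ} (hr : 0 < r) (k : ℕ) :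
    (shiftedProd r k : ℝ) = r ^ r * meanProd r k := by
  rw [shiftedProd, meanProd, Nat.cast_prod]
  conv_rhs => rw [← card_range r, ← Finset.prod_const, card_range]
  rw [← Finset.prod_mul_distrib]
  refine Finset.prod_congr rfl fun i _ => ?_
  push_cast
  field_simp

theorem meanProd_succ_left_le {r k : ℕ} (hr : 1 ≤ r) (hk : 2 ≤ k) :
    meanProd (r + 1) k ≤ (r + k) * meanProd r k := by
  have hr' : (1 : ℝ) ≤ r := by exact_mod_cast hr
  have hk' : (2 : ℝ) ≤ k := by exact_mod_cast hk
  rw [meanProd, Finset.prod_range_succ, mul_comm, meanProd]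
  refine mul_le_mul ?_ (Finset.prod_le_prod (fun i _ => by positivity) fun i _ => ?_)
    (prod_nonneg fun i _ => by positivity) (by positivity)
  · have : (k : ℝ) / (r + 1 : ℕ) ≤ k / 2 := by
      push_cast
      gcongr
      linarith
    linarith
  · gcongr
    linarith

theorem quadratic_bound {r k : ℝ} (hr : 15 ≤ r) (hk : r ≤ k) (hk2 : k ≤ r ^ 2) :
    (4 * k + r ^ 2) * (2 * (k + r ^ 2)) ≤ r ^ 2 * (r + 1) * (2 * k + r) := by
  have h1 : 0 ≤ k - r := sub_nonneg.2 hk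
  have h2 : 0 ≤ r ^ 2 - k := sub_nonneg.2 hk2
  have h3 : 0 < r ^ 2 - r := by nlinarith
  have h4 : 0 ≤ (r + 1) * (2 * r + 1) - 20 * r := by nlinarith
  have h5 : 0 ≤ r - 8 := by linarith
  refine le_of_sub_nonneg (nonneg_of_mul_nonneg_right ?_ h3)
  have h6 : (r ^ 2 - r) *
      (r ^ 2 * (r + 1) * (2 * k + r) - (4 * k + r ^ 2) * (2 * (k + r ^ 2))) =
      8 * (r ^ 2 - r) * (k - r) * (r ^ 2 - k) +
        (k - r) * (r ^ 3 * ((r + 1) * (2 * r + 1) - 20 * r)) +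
        (r ^ 2 - k) * (r ^ 2 * (r + 1) * (r - 8)) := by ring
  rw [h6]
  positivity

theorem sum_inv_le {r k : ℕ} (hr : 15 ≤ r) (hk : r ≤ k) (hk2 : k ≤ r ^ 2) :
    ∑ i ∈ range r, ((r : ℝ) * (i + 1) + k)⁻¹ ≤ 2 * (r - 2) / (2 * k + r) := by
  have hr' : (15 : ℝ) ≤ r := by exact_mod_cast hr
  have hk' : (r : ℝ) ≤ k := by exact_mod_cast hk
  have hk2' : (k : ℝ) ≤ r ^ 2 := by exact_mod_cast hk2
  have hk0 : (0 : ℝ) < k := by linarith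
  have h1 : ∀ i ∈ range r, ((r : ℝ) * (i + 1) + k)⁻¹ ≤
      (k : ℝ)⁻¹ - (i + 1) * (r / (k * (k + r ^ 2))) := by
    intro i hi
    have hi' : (i : ℝ) + 1 ≤ r := by exact_mod_cast mem_range.1 hi
    have hi0 : (0 : ℝ) ≤ i := Nat.cast_nonneg i
    have : (k : ℝ)⁻¹ - (i + 1) * (r / (k * (k + r ^ 2))) - ((r : ℝ) * (i + 1) + k)⁻¹ =
        r ^ 2 * (i + 1) * (r - (i + 1)) / (k * (k + r ^ 2) * (r * (i + 1) + k)) := by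
      field_simp
      ring
    have h2 : 0 ≤ r ^ 2 * (i + 1) * (r - (i + 1)) / (k * (k + r ^ 2) * (r * (i + 1) + k) : ℝ) := by
      have : (0 : ℝ) ≤ r - (i + 1) := by linarith
      positivity
    linarith
  refine (Finset.sum_le_sum h1).trans ?_
  have h2 : ∑ i ∈ range r, ((i : ℝ) + 1) = r * (r + 1) / 2 := by
    have h3 : ∀ m : ℕ, ∑ i ∈ range m, ((i : ℝ) + 1) = m * (m + 1) / 2 := by
      intro m
      induction m with
      | zero => simp
      | succ m ih =>
        rw [Finset.sum_range_succ, ih]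
        push_cast
        ring
    exact h3 r
  rw [Finset.sum_sub_distrib, ← Finset.sum_mul, h2, Finset.sum_const, card_range, nsmul_eq_mul]
  have h3 := quadratic_bound hr' hk' hk2'
  have h4 : 2 * ((r : ℝ) - 2) / (2 * k + r) -
      (r * (k : ℝ)⁻¹ - r * (r + 1) / 2 * (r / (k * (k + r ^ 2)))) =
      (r ^ 2 * (r + 1) * (2 * k + r) - (4 * k + r ^ 2) * (2 * (k + r ^ 2))) /
        (2 * k * (k + r ^ 2) * (2 * k + r)) := by
    field_simp
    ring
  have h5 : 0 ≤ (r ^ 2 * (r + 1) * (2 * k + r) - (4 * k + r ^ 2) * (2 * (k + r ^ 2))) /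
        (2 * k * (k + r ^ 2) * (2 * k + r) : ℝ) := by
    have := sub_nonneg.2 h3
    positivity
  linarith

theorem meanProd_succ_right_le {r k : ℕ} (hr : 15 ≤ r) (hk : r ≤ k) (hk2 : k ≤ r ^ 2) :
    (k + 1) * meanProd r (k + 1) ≤ (k + r - 1) * meanProd r k := by
  have hr' : (15 : ℝ) ≤ r := by exact_mod_cast hr
  have hk' : (r : ℝ) ≤ k := by exact_mod_cast hk
  have h1 : meanProd r (k + 1) ≤ meanProd r k *
      Real.exp (∑ i ∈ range r, ((r : ℝ) * (i + 1) + k)⁻¹) := by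
    rw [meanProd, meanProd, Real.exp_sum, ← Finset.prod_mul_distrib]
    refine Finset.prod_le_prod (fun i _ => by positivity) fun i _ => ?_
    have h2 := Real.add_one_le_exp ((r : ℝ) * (i + 1) + k)⁻¹
    refine le_trans (le_of_eq ?_)
      (mul_le_mul_of_nonneg_left h2 (by positivity : 0 ≤ (i : ℝ) + 1 + k / r))
    push_cast
    field_simp
    ring
  have h2 : Real.exp (∑ i ∈ range r, ((r : ℝ) * (i + 1) + k)⁻¹) ≤ (k + r - 1) / (k + 1) := by
    rw [← Real.le_log_iff_exp_le (div_pos (by linarith) (by linarith))]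
    refine (sum_inv_le hr hk hk2).trans ?_
    have h3 := Real.le_log_one_add_of_nonneg (x := ((r : ℝ) - 2) / (k + 1))
      (div_nonneg (by linarith) (by linarith))
    refine le_trans (le_of_eq ?_) (h3.trans (le_of_eq ?_))
    · have : (r : ℝ) - 2 + 2 * (k + 1) ≠ 0 := by linarith
      field_simp
      ring
    · congr 1
      field_simp
      ring
  calc (k + 1) * meanProd r (k + 1)
      ≤ (k + 1) * (meanProd r k * ((k + r - 1) / (k + 1))) := by
        refine mul_le_mul_of_nonneg_left (h1.trans ?_) (by positivity)
        exact mul_le_mul_of_nonneg_left h2 (meanProd_pos r k).le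
    _ = _ := by
      field_simp

end LargeRows

section Contradiction

theorem meanProd_self (r : ℕ) (hr : 0 < r) : meanProd r r = (r + 1).factorial := by
  have h : (r : ℝ) / r = 1 := div_self (by positivity)
  rw [meanProd, h, ← Finset.prod_range_add_one_eq_factorial, Finset.prod_range_succ']
  push_cast
  rw [mul_one]

theorem shiftedProd_lt_fifteen : ∀ k ∈ Icc 2 15,
    (15 + k) * (k + (k - 1)) * 2 ^ (k - 2) * k.factorial * shiftedProd 15 k <
      (15 + k).factorial * 15 ^ 15 := by
  decide +kernel

theorem meanProd_lt_fifteen {k : ℕ} (hk : 2 ≤ k) (hk2 : k ≤ 15) :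
    ((15 : ℕ) + k) * (2 * k - 1) * 2 ^ (k - 2) * k.factorial * meanProd 15 k <
      ((15 + k).factorial : ℝ) := by
  have h1 := shiftedProd_lt_fifteen k (mem_Icc.2 ⟨hk, hk2⟩)
  have h2 : ((15 + k : ℕ) * (k + (k - 1) : ℕ) * 2 ^ (k - 2) * k.factorial * shiftedProd 15 k : ℝ) <
      (15 + k).factorial * 15 ^ 15 := by exact_mod_cast h1
  rw [shiftedProd_eq_pow_mul_meanProd (by norm_num)] at h2
  have h3 : ((k + (k - 1) : ℕ) : ℝ) = 2 * k - 1 := by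
    rw [show k + (k - 1) = 2 * k - 1 by omega, Nat.cast_sub (by omega)]
    push_cast
    ring
  rw [h3] at h2
  refine lt_of_mul_lt_mul_right (lt_of_eq_of_lt ?_ h2) (by positivity : (0 : ℝ) ≤ 15 ^ 15)
  push_cast
  ring

theorem meanProd_lt_step {r k : ℕ} (hr : 1 ≤ r) (hk : 2 ≤ k)
    (h : (r + k) * (2 * k - 1) * 2 ^ (k - 2) * k.factorial * meanProd r k <
      ((r + k).factorial : ℝ)) :
    ((r + 1 : ℕ) + k) * (2 * k - 1) * 2 ^ (k - 2) * k.factorial * meanProd (r + 1) k <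
      ((r + 1 + k).factorial : ℝ) := by
  have hk' : (2 : ℝ) ≤ k := by exact_mod_cast hk
  have h0 : (0 : ℝ) ≤ 2 * k - 1 := by linarith
  have h1 := meanProd_succ_left_le hr hk
  rw [show r + 1 + k = (r + k) + 1 by ring, Nat.factorial_succ, Nat.cast_mul]
  calc ((r + 1 : ℕ) + k) * (2 * k - 1) * 2 ^ (k - 2) * k.factorial * meanProd (r + 1) k
      ≤ ((r + 1 : ℕ) + k) * (2 * k - 1) * 2 ^ (k - 2) * k.factorial *
          ((r + k) * meanProd r k) := by gcongr
    _ = ((r + k + 1 : ℕ) : ℝ) *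
          ((r + k) * (2 * k - 1) * 2 ^ (k - 2) * k.factorial * meanProd r k) := by
        push_cast
        ring
    _ < _ := mul_lt_mul_of_pos_left h (by positivity)

theorem meanProd_self_lt {k : ℕ} (hk : 15 ≤ k) :
    (k + k) * (2 * k - 1) * 2 ^ (k - 2) * k.factorial * meanProd k k <
      ((k + k).factorial : ℝ) := by
  induction k, hk using Nat.le_induction with
  | base => exact_mod_cast meanProd_lt_fifteen (by norm_num) le_rfl
  | succ k hk ih =>
    have hk' : (15 : ℝ) ≤ k := by exact_mod_cast hk
    rw [meanProd_self _ (by omega)] at ih ⊢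
    rw [show k + 1 + (k + 1) = (k + k + 1) + 1 by ring, Nat.factorial_succ (k + k + 1),
      Nat.factorial_succ (k + k), Nat.factorial_succ (k + 1), show k + 1 - 2 = k - 2 + 1 by omega]
    rw [Nat.factorial_succ k] at ih ⊢
    push_cast at ih ⊢
    have h1 : 2 * ((k : ℝ) + 1) * (k + 2) ≤ 2 * k * (2 * k - 1) := by nlinarith
    calc _ = ((k : ℝ) + k + 1 + 1) * ((k + k + 1) * (2 ^ (k - 2) * k.factorial *
          ((k + 1) * k.factorial) * (2 * ((k : ℝ) + 1) * (k + 2)))) := by ring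
      _ ≤ ((k : ℝ) + k + 1 + 1) * ((k + k + 1) * (2 ^ (k - 2) * k.factorial *
          ((k + 1) * k.factorial) * (2 * k * (2 * k - 1)))) := by gcongr
      _ = ((k : ℝ) + k + 1 + 1) * ((k + k + 1) * ((k + k) * (2 * k - 1) * 2 ^ (k - 2) *
          k.factorial * ((k + 1) * k.factorial))) := by ring
      _ < _ := by gcongr

theorem meanProd_lt_of_le {r k : ℕ} (hr : 15 ≤ r) (hk : 2 ≤ k) (hkr : k ≤ r) :
    (r + k) * (2 * k - 1) * 2 ^ (k - 2) * k.factorial * meanProd r k <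
      ((r + k).factorial : ℝ) := by
  obtain h | h := le_total k 15
  · induction r, hr using Nat.le_induction with
    | base => exact meanProd_lt_fifteen hk h
    | succ r hr ih => exact meanProd_lt_step (by omega) hk (ih (h.trans hr))
  · induction r, hkr using Nat.le_induction with
    | base => exact meanProd_self_lt h
    | succ r hkr ih => exact meanProd_lt_step (by omega) hk (ih (h.trans hkr))

theorem meanProd_lt_of_ge {r k : ℕ} (hr : 15 ≤ r) (hk : r ≤ k) (hk2 : k ≤ r ^ 2) :
    (r + k) * (k + r - 1) * 2 ^ (r - 2) * k.factorial * meanProd r k <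
      ((r + k).factorial : ℝ) := by
  have hr' : (15 : ℝ) ≤ r := by exact_mod_cast hr
  induction k, hk using Nat.le_induction with
  | base =>
    refine lt_of_eq_of_lt ?_ (meanProd_self_lt hr)
    ring
  | succ k hk ih =>
    have hk' : (r : ℝ) ≤ k := by exact_mod_cast hk
    have h1 := meanProd_succ_right_le hr hk (by omega)
    have h2 := ih (by omega)
    rw [← add_assoc, Nat.factorial_succ (r + k), Nat.factorial_succ k]
    push_cast
    calc _ = ((r : ℝ) + k + 1) * ((r + k) * 2 ^ (r - 2) * k.factorial *
          ((k + 1) * meanProd r (k + 1))) := by ring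
      _ ≤ ((r : ℝ) + k + 1) * ((r + k) * 2 ^ (r - 2) * k.factorial *
          ((k + r - 1) * meanProd r k)) := by gcongr
      _ = ((r : ℝ) + k + 1) * ((r + k) * (k + r - 1) * 2 ^ (r - 2) * k.factorial *
          meanProd r k) := by ring
      _ < _ := by gcongr

theorem mul_shiftedProd_lt {r k : ℕ} (hr : 15 ≤ r) (hk : 2 ≤ k) (hk2 : k ≤ r ^ 2) :
    (k + r) * (k + (min k r - 1)) * 2 ^ (min k r - 2) * k.factorial * shiftedProd r k <
      (k + r).factorial * r ^ r := by
  have hr0 : (0 : ℝ) < r ^ r := by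
    have : (15 : ℝ) ≤ r := by exact_mod_cast hr
    positivity
  suffices h : (r + k) * (k + (min k r - 1) : ℕ) * 2 ^ (min k r - 2) * k.factorial * meanProd r k <
      ((r + k).factorial : ℝ) by
    have h1 : ((k + r : ℕ) * (k + (min k r - 1) : ℕ) * 2 ^ (min k r - 2) * k.factorial *
        shiftedProd r k : ℝ) < (k + r).factorial * r ^ r := by
      rw [shiftedProd_eq_pow_mul_meanProd (by omega), add_comm k r]
      refine lt_of_eq_of_lt ?_ (mul_lt_mul_of_pos_right h hr0)
      push_cast
      ring
    exact_mod_cast h1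
  obtain h | h := le_total k r
  · rw [min_eq_left h]
    have h1 := meanProd_lt_of_le hr hk h
    have h2 : ((k + (k - 1) : ℕ) : ℝ) = 2 * k - 1 := by
      rw [show k + (k - 1) = 2 * k - 1 by omega, Nat.cast_sub (by omega)]
      push_cast
      ring
    rwa [h2]
  · rw [min_eq_right h]
    have h1 := meanProd_lt_of_ge hr h hk2
    have h2 : ((k + (r - 1) : ℕ) : ℝ) = k + r - 1 := by
      rw [show k + (r - 1) = k + r - 1 by omega, Nat.cast_sub (by omega)]
      push_cast
      ring
    rwa [h2]

end Contradiction

section Classification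

theorem pairTest_of_rowTest {r : ℕ} : ∀ {m k : ℕ}, rowTest r m = true → 2 ≤ k → k ≤ m + 1 →
    pairTest r k = true
  | 0, k, _, h2, h3 => by omega
  | m + 1, k, h1, h2, h3 => by
    rw [rowTest, Bool.and_eq_true] at h1
    obtain h | h := Nat.lt_or_ge k (m + 2)
    · exact pairTest_of_rowTest h1.2 h2 (by omega)
    · rw [show k = m + 2 by omega]
      exact h1.1

set_option maxRecDepth 100000 in
theorem rowTest_of_lt_fifteen : ∀ r < 15, rowTest r (r * (r - 1) - 1) = true := by
  decide +kernel

theorem betaSize_classification {p d : ℕ} (hp : p.Prime) (hd : 1 ≤ d) {H : Finset ℕ}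
    (hD : p ^ d * hookProd H = (betaSize H).factorial) :
    betaSize H = p ^ d + 1 ∨
    (betaSize H = 4 ∧ p ^ d = 2) ∨
    (betaSize H = 5 ∧ p ^ d = 5) ∨
    (betaSize H = 6 ∧ (p ^ d = 9 ∨ p ^ d = 16)) ∨
    (betaSize H = 8 ∧ p ^ d = 64) ∨
    (betaSize H = 9 ∧ p ^ d = 27) := by
  obtain ⟨K, hK, hK2, hKH⟩ := exists_normalized_hookLengths_eq H
  rw [← prod_hookLengths, ← card_hookLengths, ← hKH, prod_hookLengths, card_hookLengths] at hD
  rw [← card_hookLengths, ← hKH, card_hookLengths]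
  obtain ⟨k, hk⟩ : ∃ k, betaSize K = k + #K :=
    ⟨_, betaSize_eq_betaSize_image_pred_add hK⟩
  have h1 : 2 ≤ p ^ d := hp.two_le.trans (Nat.le_self_pow (by omega) p)
  obtain h | h | h : k = 0 ∨ k = 1 ∨ 2 ≤ k := by omega
  · have := eq_one_of_betaSize_eq_card hK (by omega) hD
    omega
  · exact Or.inl (betaSize_eq_add_one_of_betaSize_eq_card_add_one hK (by omega) hD)
  have hkr := le_card_mul_card_sub_one hK hK2 hk
  have hr2 : 2 ≤ #K := by
    by_contra hr
    obtain h0 | h0 : #K = 0 ∨ #K = 1 := by omega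
    all_goals
      rw [h0] at hkr
      omega
  have hle := card_pow_mul_prod_le_shiftedProd hk
  obtain hr | hr := Nat.lt_or_ge #K 15
  · exact of_pairTest hp hd hK hK2 hk h hr2 hD hle
      (pairTest_of_rowTest (rowTest_of_lt_fifteen _ hr) h (by omega))
  · exfalso
    have h2 := factorial_le_of_prime_pow_mul_hookProd hp hK hk h hr2 hD
    have h3 := mul_shiftedProd_lt hr h (hkr.trans (by
      rw [pow_two]
      exact Nat.mul_le_mul_left _ (Nat.sub_le _ _)))
    refine h3.not_ge ?_
    calc _ ≤ (k + #K) * (k + (min k #K - 1)) * 2 ^ (min k #K - 2) * k.factorial *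
          (∏ x ∈ K, x) * #K ^ #K := Nat.mul_le_mul_right _ h2
      _ = (k + #K) * (k + (min k #K - 1)) * 2 ^ (min k #K - 2) * k.factorial *
          (#K ^ #K * ∏ x ∈ K, x) := by ring
      _ ≤ _ := Nat.mul_le_mul_left _ hle

end Classification

end

theorem stmt7 (n : ℕ) (hn : 1 ≤ n) (p d : ℕ) (hp : p.Prime) (hd : 1 ≤ d)
    (h : p ^ d ∈ cd (Equiv.Perm (Fin n))) :
    n = p ^ d + 1 ∨
    (n = 4 ∧ p ^ d = 2) ∨
    (n = 5 ∧ p ^ d = 5) ∨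
    (n = 6 ∧ (p ^ d = 9 ∨ p ^ d = 16)) ∨
    (n = 8 ∧ p ^ d = 64) ∨
    (n = 9 ∧ p ^ d = 27) := by
  obtain ⟨V, hV, hVd⟩ := h
  obtain ⟨H, rfl, hH⟩ := exists_finrank_mul_hookProd V
  rw [hVd] at hH
  exact betaSize_classification hp hd hH
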